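/- arXiv:2407.21551 — 15 statements merged into one kernel-verified Lean document; each statement's English description precedes it below -/
import Mathlib

section
/- For every r > 0 and h > 0, the equation ȳ = ȳ·exp(r − ȳ) + h has exactly one nonnegative real solution ȳ; moreover this solution satisfies ȳ > r and ȳ > h. -/
/-- A nonnegative equilibrium exceeds both the growth rate and the stocking rate. -/
lemma lt_of_ricker_equilibrium {r h y : ℝ} (hh : 0 < h) (hy : 0 ≤ y)
    (e : y = y * Real.exp (r - y) + h) : r < y ∧ h < y := by
  have hexp := Real.exp_pos (r - y)
  have hpos : 0 < y := by nlinarith [mul_nonneg hy hexp.le]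
  refine ⟨?_, by nlinarith [mul_pos hpos hexp]⟩
  by_contra! hle
  have h1 : 1 ≤ Real.exp (r - y) := Real.one_le_exp (by linarith)
  nlinarith

/-- The map `y ↦ y - y * exp (r - y)` is strictly increasing on `[r, ∞)`. -/
lemma strictMonoOn_sub_mul_exp {r : ℝ} (hr : 0 < r) :
    StrictMonoOn (fun y : ℝ => y - y * Real.exp (r - y)) (Set.Ici r) := by
  intro a ha b hb hab
  have ha' : r ≤ a := ha
  have h1 : Real.exp (r - a) ≤ 1 := Real.exp_le_one_iff.mpr (by linarith)
  have h2 : Real.exp (r - b) < Real.exp (r - a) := Real.exp_lt_exp.mpr (by linarith)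
  change a - a * Real.exp (r - a) < b - b * Real.exp (r - b)
  nlinarith [mul_pos (show 0 < b by linarith) (sub_pos.mpr h2),
    mul_nonneg (sub_pos.mpr hab).le (sub_nonneg.mpr h1)]

lemma exists_ricker_equilibrium {r h : ℝ} (hr : 0 < r) (hh : 0 < h) :
    ∃ y : ℝ, 0 ≤ y ∧ y = y * Real.exp (r - y) + h := by
  have hcont : ContinuousOn (fun y : ℝ => y - y * Real.exp (r - y)) (Set.Icc r (r + h + 1)) := by
    fun_prop
  have hmem : h ∈ Set.Icc (r - r * Real.exp (r - r))
      (r + h + 1 - (r + h + 1) * Real.exp (r - (r + h + 1))) := by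
    have hprod : Real.exp (r - (r + h + 1)) * Real.exp (h + 1) = 1 := by
      rw [← Real.exp_add, Real.exp_eq_one_iff]; ring
    have hpos := Real.exp_pos (r - (r + h + 1))
    have hle : Real.exp (r - (r + h + 1)) ≤ 1 := Real.exp_le_one_iff.mpr (by linarith)
    have hmul := mul_le_mul_of_nonneg_left (Real.add_one_le_exp (h + 1)) hpos.le
    constructor
    · simpa using hh.le
    · nlinarith [mul_nonneg hr.le (sub_nonneg.mpr hle)]
  obtain ⟨y, hy, e⟩ := intermediate_value_Icc (by linarith) hcont hmem
  exact ⟨y, hr.le.trans hy.1, by linarith⟩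

/-- For every `r > 0` and `h > 0`, the equation `ȳ = ȳ·exp(r − ȳ) + h` has exactly one
nonnegative real solution `ȳ`; moreover this solution satisfies `ȳ > r` and `ȳ > h`. -/
theorem ricker_stocking_unique_equilibrium (r h : ℝ) (hr : 0 < r) (hh : 0 < h) :
    (∃! y : ℝ, 0 ≤ y ∧ y = y * Real.exp (r - y) + h) ∧
    (∀ y : ℝ, 0 ≤ y → y = y * Real.exp (r - y) + h → r < y ∧ h < y) := by
  refine ⟨?_, fun y hy e => lt_of_ricker_equilibrium hh hy e⟩
  obtain ⟨y, hy, e⟩ := exists_ricker_equilibrium hr hh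
  refine ⟨y, ⟨hy, e⟩, fun z ⟨hz, ez⟩ => ?_⟩
  refine (strictMonoOn_sub_mul_exp hr).injOn (lt_of_ricker_equilibrium hh hz ez).1.le
    (lt_of_ricker_equilibrium hh hy e).1.le ?_
  linarith
end

section
/- Let r > 0 and 0 < h₁ < h₂, and let ȳ₁, ȳ₂ > 0 satisfy ȳ₁ = ȳ₁·exp(r − ȳ₁) + h₁ and ȳ₂ = ȳ₂·exp(r − ȳ₂) + h₂. Then ȳ₁ < ȳ₂; that is, the equilibrium of the Ricker model with delay and constant stocking is strictly increasing in the stocking parameter h. -/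
/-- The equilibrium of the Ricker model with delay and constant stocking is strictly
increasing in the stocking parameter `h`. -/
theorem ricker_stocking_equilibrium_strictMono_in_h (r h₁ h₂ y₁ y₂ : ℝ)
    (hr : 0 < r) (hh₁ : 0 < h₁) (hh : h₁ < h₂)
    (hy₁pos : 0 < y₁) (hy₂pos : 0 < y₂)
    (heq₁ : y₁ = y₁ * Real.exp (r - y₁) + h₁)
    (heq₂ : y₂ = y₂ * Real.exp (r - y₂) + h₂) :
    y₁ < y₂ := by
  by_contra! hle
  have hexp_le : Real.exp (r - y₁) ≤ Real.exp (r - y₂) := Real.exp_le_exp.mpr (by linarith)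
  have hexp_lt_one : Real.exp (r - y₂) < 1 := by
    by_contra! hge
    nlinarith [mul_le_mul_of_nonneg_left hge hy₂pos.le]
  nlinarith [mul_nonneg (sub_nonneg.mpr hle) (sub_nonneg.mpr hexp_lt_one.le),
    mul_nonneg hy₁pos.le (sub_nonneg.mpr hexp_le)]
end

section
/- Let h > 0 and 0 < r₁ < r₂, and let ȳ₁, ȳ₂ > 0 satisfy ȳ₁ = ȳ₁·exp(r₁ − ȳ₁) + h and ȳ₂ = ȳ₂·exp(r₂ − ȳ₂) + h. Then ȳ₁ < ȳ₂; that is, the equilibrium of the Ricker model with delay and constant stocking is strictly increasing in the intrinsic growth parameter r. -/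
/-- The equilibrium of the Ricker model with delay and constant stocking is strictly
increasing in the intrinsic growth parameter `r`. -/
theorem ricker_stocking_equilibrium_strictMono_in_r (h r₁ r₂ y₁ y₂ : ℝ)
    (hh : 0 < h) (hr₁ : 0 < r₁) (hr : r₁ < r₂)
    (hy₁pos : 0 < y₁) (hy₂pos : 0 < y₂)
    (heq₁ : y₁ = y₁ * Real.exp (r₁ - y₁) + h)
    (heq₂ : y₂ = y₂ * Real.exp (r₂ - y₂) + h) :
    y₁ < y₂ := by
  by_contra! hle
  have hexp : Real.exp (r₁ - y₁) < Real.exp (r₂ - y₂) := Real.exp_lt_exp.2 (by linarith)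
  have hpos : 0 < 1 - Real.exp (r₂ - y₂) :=
    pos_of_mul_pos_right (by linarith : 0 < y₂ * (1 - Real.exp (r₂ - y₂))) hy₂pos.le
  have hlt := mul_lt_mul_of_pos_left hexp hy₁pos
  have hmul := mul_le_mul_of_nonneg_right hle hpos.le
  linarith
end

section
/- Let r > 0, h > 0 and let ȳ > 0 satisfy ȳ = ȳ·exp(r − ȳ) + h. Then ȳ < h + 1 if and only if r < h + 1 − ln(h + 1). -/
/-- The growth rate for which `y` is an equilibrium under stocking `h`, as a function of `y > h`,
is strictly increasing. -/
theorem ricker_stocking_rate_strictMonoOn {h : ℝ} (hh : 0 ≤ h) :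
    StrictMonoOn (fun y : ℝ => y + Real.log ((y - h) / y)) (Set.Ioi h) := by
  intro a ha b hb hab
  rw [Set.mem_Ioi] at ha hb
  have ha0 : 0 < a := hh.trans_lt ha
  have hb0 : 0 < b := hh.trans_lt hb
  refine add_lt_add_of_lt_of_le hab
    (Real.log_le_log (div_pos (sub_pos.2 ha) ha0) ?_)
  rw [div_le_div_iff₀ ha0 hb0]
  nlinarith

/-- For the equilibrium `ȳ` of the Ricker model with delay and constant stocking,
`ȳ < h + 1` if and only if `r < h + 1 − ln(h + 1)`. -/
theorem ricker_stocking_equilibrium_lt_iff (r h y : ℝ)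
    (hr : 0 < r) (hh : 0 < h) (hypos : 0 < y)
    (heq : y = y * Real.exp (r - y) + h) :
    y < h + 1 ↔ r < h + 1 - Real.log (h + 1) := by
  have hy : h < y := by
    have := mul_pos hypos (Real.exp_pos (r - y))
    linarith
  have hrate : y + Real.log ((y - h) / y) = r := by
    have hexp : (y - h) / y = Real.exp (r - y) := by
      rw [div_eq_iff hypos.ne']
      linarith
    rw [hexp, Real.log_exp]
    ring
  have hthreshold : h + 1 + Real.log ((h + 1 - h) / (h + 1)) = h + 1 - Real.log (h + 1) := by
    rw [add_sub_cancel_left, one_div, Real.log_inv, ← sub_eq_add_neg]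
  rw [← hthreshold, ← hrate]
  exact ((ricker_stocking_rate_strictMonoOn hh.le).lt_iff_lt hy (lt_add_one h)).symm
end

section
/- For every h > 0, with r1 = h + 1 − ln(h + 1), H* = (h + √(h² + 4h))/2 and r2 = H* + ln(H* − h) − ln(H*), one has r2 < r1. -/
/-- For every `h > 0`, with `r1 = h + 1 − ln(h + 1)`, `H* = (h + √(h² + 4h))/2` and
`r2 = H* + ln(H* − h) − ln(H*)`, one has `r2 < r1`. -/
theorem ricker_stocking_r2_lt_r1 (h r1 r2 Hstar : ℝ) (hh : 0 < h)
    (hr1 : r1 = h + 1 - Real.log (h + 1))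
    (hH : Hstar = (h + Real.sqrt (h ^ 2 + 4 * h)) / 2)
    (hr2 : r2 = Hstar + Real.log (Hstar - h) - Real.log Hstar) :
    r2 < r1 := by
  have hsqrt : Real.sqrt (h ^ 2 + 4 * h) ^ 2 = h ^ 2 + 4 * h := Real.sq_sqrt (by positivity)
  have hlt : h < Real.sqrt (h ^ 2 + 4 * h) := Real.lt_sqrt_of_sq_lt (by linarith)
  have hHh : h < Hstar := by linarith
  have hHpos : 0 < Hstar := hh.trans hHh
  have hquad : (Hstar - h) * (Hstar + 1) = Hstar := by
    rw [hH]; linear_combination hsqrt / 4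
  have hlog : Real.log (Hstar - h) + Real.log (Hstar + 1) = Real.log Hstar := by
    rw [← Real.log_mul (by linarith) (by linarith), hquad]
  have hdiff : Hstar - h < 1 := by nlinarith
  have hmono : Real.log (h + 1) < Real.log (Hstar + 1) :=
    Real.log_lt_log (by linarith) (by linarith)
  linarith
end

section
/- Let r > 0 and 0 < h ≤ r, and let ȳ > 0 satisfy ȳ = ȳ·exp(r − ȳ) + h. Then H* ≤ ȳ, where H* = (h + √(h² + 4h))/2. -/
/-- If `h ≤ r`, then `H* ≤ ȳ`, where `H* = (h + √(h² + 4h))/2` and `ȳ` is the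
equilibrium of the Ricker model with delay and constant stocking. -/
theorem ricker_stocking_Hstar_le_equilibrium (r h y : ℝ)
    (hr : 0 < r) (hh : 0 < h) (hhr : h ≤ r) (hypos : 0 < y)
    (heq : y = y * Real.exp (r - y) + h) :
    (h + Real.sqrt (h ^ 2 + 4 * h)) / 2 ≤ y := by
  have hexp : h - y + 1 ≤ Real.exp (r - y) := by
    linarith [Real.add_one_le_exp (r - y)]
  have hquad : y * (h - y + 1) ≤ y - h := by
    linarith [mul_le_mul_of_nonneg_left hexp hypos.le]
  have hhy : h < y := by
    linarith [mul_pos hypos (Real.exp_pos (r - y))]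
  have hsqrt : Real.sqrt (h ^ 2 + 4 * h) ≤ 2 * y - h :=
    Real.sqrt_le_iff.mpr ⟨by linarith, by nlinarith⟩
  linarith
end

section
/- Let 0 < h < r. If x, y > 0 satisfy y = y·exp(r − x) + h and x = x·exp(r − y) + h, then x = y; hence the only positive solution of this system is (ȳ, ȳ) where ȳ is the equilibrium. -/
/-- The chord slope `(exp t - 1) / t` is monotone on the positive reals, in cross-multiplied form. -/
lemma mul_exp_sub_one_le {a b : ℝ} (ha : 0 ≤ a) (hab : a ≤ b) :
    b * (Real.exp a - 1) ≤ a * (Real.exp b - 1) := by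
  have hmul : Real.exp a * (1 + (b - a)) ≤ Real.exp b := by
    calc Real.exp a * (1 + (b - a)) ≤ Real.exp a * Real.exp (b - a) := by
          gcongr
          linarith [Real.add_one_le_exp (b - a)]
      _ = Real.exp b := by rw [← Real.exp_add]; ring_nf
  have hneg : 0 ≤ Real.exp a * (a - 1) + 1 := by
    have := mul_le_mul_of_nonneg_left (Real.add_one_le_exp (-a)) (Real.exp_pos a).le
    rw [← Real.exp_add, add_neg_cancel, Real.exp_zero] at this
    linarith
  nlinarith [mul_le_mul_of_nonneg_left hmul ha, mul_nonneg (sub_nonneg.2 hab) hneg]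

lemma ricker_stocking_curves_not_lt {r h x y : ℝ} (hh : 0 < h) (hhr : h < r) (hy : 0 < y)
    (h₁ : y = y * Real.exp (r - x) + h) (h₂ : x = x * Real.exp (r - y) + h) :
    ¬ x < y := by
  intro hxy
  have hrx : r < x := by
    by_contra! hle
    have : 1 ≤ Real.exp (r - x) := Real.one_le_exp (by linarith)
    nlinarith
  have hP : Real.exp (r - x) * Real.exp (x - r) = 1 := by
    rw [← Real.exp_add]; simp
  have hQ : Real.exp (r - y) * Real.exp (y - r) = 1 := by
    rw [← Real.exp_add]; simp
  have e₁ : y * Real.exp (x - r) = y + h * Real.exp (x - r) := by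
    linear_combination Real.exp (x - r) * h₁ + y * hP
  have e₂ : x * Real.exp (y - r) = x + h * Real.exp (y - r) := by
    linear_combination Real.exp (y - r) * h₂ + x * hQ
  have hlt : Real.exp (x - r) < Real.exp (y - r) := Real.exp_lt_exp.2 (by linarith)
  have hslope := mul_exp_sub_one_le (a := x - r) (b := y - r) (by linarith) (by linarith)
  nlinarith [mul_pos (sub_pos.2 hhr) (sub_pos.2 hlt)]

/-- If `0 < h < r` and `x, y > 0` satisfy `y = y·exp(r − x) + h` and
`x = x·exp(r − y) + h`, then `x = y`. -/
theorem ricker_stocking_curves_unique_intersection (r h x y : ℝ)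
    (hh : 0 < h) (hhr : h < r) (hx : 0 < x) (hy : 0 < y)
    (h₁ : y = y * Real.exp (r - x) + h)
    (h₂ : x = x * Real.exp (r - y) + h) :
    x = y :=
  le_antisymm (not_lt.1 (ricker_stocking_curves_not_lt hh hhr hx h₂ h₁))
    (not_lt.1 (ricker_stocking_curves_not_lt hh hhr hy h₁ h₂))
end

section
/- Let h > 0 and 0 < r satisfy r < r2 < h, where H* = (h + √(h² + 4h))/2 and r2 = H* + ln(H* − h) − ln(H*). Then the equilibrium ȳ (the positive solution of ȳ = ȳ·exp(r − ȳ) + h) satisfies ȳ < H*, and the only pair (x, y) with x, y > 0 satisfying y = y·exp(r − x) + h and x = x·exp(r − y) + h is (x, y) = (ȳ, ȳ). -/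
open Real in
theorem sinh_le_mul_cosh {D : ℝ} (hD : 0 ≤ D) : sinh D ≤ D * cosh D := by
  have hderiv (t : ℝ) : HasDerivAt (fun t => t * cosh t - sinh t) (t * sinh t) t := by
    refine (((hasDerivAt_id t).mul (hasDerivAt_cosh t)).sub (hasDerivAt_sinh t)).congr_deriv ?_
    simp
  have hmono : MonotoneOn (fun t => t * cosh t - sinh t) (Set.Ici 0) := by
    refine monotoneOn_of_hasDerivWithinAt_nonneg (convex_Ici 0)
      (fun t _ => (hderiv t).continuousAt.continuousWithinAt)
      (fun t _ => (hderiv t).hasDerivWithinAt) fun t ht => ?_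
    rw [interior_Ici] at ht
    exact mul_nonneg ht.le (sinh_nonneg_iff.2 ht.le)
  have := hmono (Set.mem_Ici.2 le_rfl) hD hD
  simp only [sinh_zero, zero_mul, sub_zero] at this
  linarith

open Real in
theorem three_mul_sinh_sq_le {D : ℝ} (hD : 0 ≤ D) :
    3 * sinh D ^ 2 ≤ D ^ 2 + 2 * D * (sinh D * cosh D) := by
  have hderiv (t : ℝ) : HasDerivAt
      (fun t => t ^ 2 + 2 * t * (sinh t * cosh t) - 3 * sinh t ^ 2)
      (4 * cosh t * (t * cosh t - sinh t)) t := by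
    refine ((((hasDerivAt_id t).pow 2).add (((hasDerivAt_id t).const_mul 2).mul
      ((hasDerivAt_sinh t).mul (hasDerivAt_cosh t)))).sub
      (((hasDerivAt_sinh t).pow 2).const_mul 3)).congr_deriv ?_
    simp only [id, Pi.mul_apply]
    push_cast
    linear_combination -2 * t * cosh_sq t
  have hmono : MonotoneOn
      (fun t => t ^ 2 + 2 * t * (sinh t * cosh t) - 3 * sinh t ^ 2) (Set.Ici 0) := by
    refine monotoneOn_of_hasDerivWithinAt_nonneg (convex_Ici 0)
      (fun t _ => (hderiv t).continuousAt.continuousWithinAt)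
      (fun t _ => (hderiv t).hasDerivWithinAt) fun t ht => ?_
    rw [interior_Ici] at ht
    have := sinh_le_mul_cosh ht.le
    exact mul_nonneg (by positivity) (by linarith)
  have := hmono (Set.mem_Ici.2 le_rfl) hD hD
  simp only [sinh_zero] at this
  linarith

open Real in
/-- If `E = D * coth D`, `k = D / sinh D` and `k * cosh M = cosh S - 1 + E`, then
`sinh S - S ≤ k * sinh M - M`; here `k * sinh M` and `M` are written in terms of `S`. -/
theorem sinh_sub_self_le {D E S : ℝ} (hD : 0 < D) (hE : E * sinh D = D * cosh D) (hS : 0 ≤ S) :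
    sinh S - S ≤ √((cosh S - 1) ^ 2 + 2 * (cosh S - 1) * E + D ^ 2)
      - log (cosh S - 1 + E + √((cosh S - 1) ^ 2 + 2 * (cosh S - 1) * E + D ^ 2))
      + log (D / sinh D) := by
  have hs : 0 < sinh D := sinh_pos_iff.2 hD
  have hE1 : 1 ≤ E := by
    have := sinh_le_mul_cosh hD.le
    by_contra! hlt
    nlinarith
  have hquad : D ^ 2 ≤ E ^ 2 + 2 * E - 3 := by
    have h1 := three_mul_sinh_sq_le hD.le
    have h2 : E ^ 2 * sinh D ^ 2 = D ^ 2 * (sinh D ^ 2 + 1) := by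
      rw [← cosh_sq, ← mul_pow, hE, mul_pow]
    have h3 : 2 * D * (sinh D * cosh D) = 2 * E * sinh D ^ 2 := by
      linear_combination -2 * sinh D * hE
    have : D ^ 2 * sinh D ^ 2 ≤ (E ^ 2 + 2 * E - 3) * sinh D ^ 2 := by linarith
    exact le_of_mul_le_mul_right this (by positivity)
  set A : ℝ → ℝ := fun t => (cosh t - 1) ^ 2 + 2 * (cosh t - 1) * E + D ^ 2 with hA
  have hApos (t : ℝ) : 0 < A t := by
    have := one_le_cosh t
    have : 0 ≤ (cosh t - 1) * E := mul_nonneg (by linarith) (by linarith)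
    have : 0 < D ^ 2 := by positivity
    simp only [hA]
    nlinarith [sq_nonneg (cosh t - 1)]
  have hsum (t : ℝ) : 0 < cosh t - 1 + E + √(A t) := by
    have := one_le_cosh t
    have := sqrt_nonneg (A t)
    linarith
  have hderiv (t : ℝ) : HasDerivAt
      (fun t => √(A t) - log (cosh t - 1 + E + √(A t)) - sinh t + t)
      (sinh t * (cosh t - 2 + E) / √(A t) - (cosh t - 1)) t := by
    have hC : HasDerivAt (fun t => cosh t - 1) (sinh t) t := (hasDerivAt_cosh t).sub_const 1
    have hA' : HasDerivAt A (2 * sinh t * (cosh t - 1 + E)) t := by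
      refine (((hC.pow 2).add ((hC.const_mul 2).mul_const E)).add_const (D ^ 2)).congr_deriv ?_
      push_cast
      ring
    have hsq := hA'.sqrt (hApos t).ne'
    have hlog := ((hC.add_const E).add hsq).log (hsum t).ne'
    refine (((hsq.sub hlog).sub (hasDerivAt_sinh t)).add (hasDerivAt_id t)).congr_deriv ?_
    have h1 := (sqrt_pos.2 (hApos t)).ne'
    have h2 := (hsum t).ne'
    simp only [Pi.add_apply]
    field_simp
    ring
  have hmono : MonotoneOn
      (fun t => √(A t) - log (cosh t - 1 + E + √(A t)) - sinh t + t) (Set.Ici 0) := by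
    refine monotoneOn_of_hasDerivWithinAt_nonneg (convex_Ici 0)
      (fun t _ => (hderiv t).continuousAt.continuousWithinAt)
      (fun t _ => (hderiv t).hasDerivWithinAt) fun t ht => ?_
    rw [interior_Ici] at ht
    have hc := one_le_cosh t
    have hst : 0 ≤ sinh t := sinh_nonneg_iff.2 ht.le
    rw [sub_nonneg, le_div_iff₀ (sqrt_pos.2 (hApos t))]
    refine (pow_le_pow_iff_left₀ (mul_nonneg (by linarith) (sqrt_nonneg _))
      (mul_nonneg hst (by linarith)) two_ne_zero).1 ?_
    rw [mul_pow, mul_pow, sq_sqrt (hApos t).le, sinh_sq]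
    have key : 0 ≤ (cosh t - 1) *
        ((cosh t - 1) * (E ^ 2 + 2 * E - 3 - D ^ 2) + 2 * (E - 1) ^ 2) := by
      have : 0 ≤ (cosh t - 1) * (E ^ 2 + 2 * E - 3 - D ^ 2) :=
        mul_nonneg (by linarith) (by linarith)
      exact mul_nonneg (by linarith) (by positivity)
    simp only [hA]
    linarith
  have h0 := hmono (Set.mem_Ici.2 le_rfl) hS hS
  have hA0 : √(A 0) = D := by simp [hA, sqrt_sq hD.le]
  have hlog0 : log (E + D) = D + log (D / sinh D) := by
    have : E + D = exp D * (D / sinh D) := by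
      rw [← cosh_add_sinh]
      field_simp
      linarith
    rw [this, log_mul (exp_pos D).ne' (by positivity), log_exp]
  simp only [hA0, cosh_zero, sinh_zero, sub_self, zero_add, hlog0] at h0
  linarith

open Real in
/-- The stocking level `a * (1 - exp (r - a))` for which `a` is an equilibrium is strictly
increasing in `a` as long as it is positive. -/
theorem stocking_lt_stocking {r a b : ℝ} (ha : 0 < a) (hpos : 0 < a * (1 - exp (r - a)))
    (hab : a < b) : a * (1 - exp (r - a)) < b * (1 - exp (r - b)) := by
  have h1 : exp (r - b) < exp (r - a) := exp_lt_exp.2 (by linarith)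
  have h2 : 0 < 1 - exp (r - a) := pos_of_mul_pos_right hpos ha.le
  nlinarith

open Real in
/-- An off-diagonal positive solution forces `r` to be at least the value at which the
equilibrium equals `H`, where `H * (H - h) = h`. -/
theorem le_of_offDiagonal_solution {r h H x y : ℝ} (hh : 0 < h) (hH : h < H)
    (hHh : H * (H - h) = h) (hx : 0 < x) (hxy : x < y)
    (h1 : y = y * exp (r - x) + h) (h2 : x = x * exp (r - y) + h) :
    H + log (H - h) - log H ≤ r := by
  have hy : 0 < y := hx.trans hxy
  have hH0 : 0 < H := hh.trans hH
  have hHs : 0 < H - h := sub_pos.2 hH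
  set D := (y - x) / 2 with hDdef
  set M := (x + y) / 2 - r with hMdef
  set E := x * y / h - (x + y) / 2 with hEdef
  have hD : 0 < D := by simp only [hDdef]; linarith
  have hs : 0 < sinh D := sinh_pos_iff.2 hD
  have e1 : exp D = exp M * ((y - h) / y) := by
    have : (y - h) / y = exp (r - x) := by
      field_simp
      linarith
    rw [this, ← exp_add]
    congr 1
    simp only [hDdef, hMdef]
    ring
  have e2 : exp (-D) = exp M * ((x - h) / x) := by
    have : (x - h) / x = exp (r - y) := by
      field_simp
      linarith
    rw [this, ← exp_add]
    congr 1
    simp only [hDdef, hMdef]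
    ring
  have hsinh : sinh D = exp M * (h * D / (x * y)) := by
    rw [sinh_eq, e1, e2]
    simp only [hDdef]
    field_simp
    ring
  have hE : E * sinh D = D * cosh D := by
    rw [hsinh, cosh_eq, e1, e2]
    simp only [hEdef]
    field_simp
    ring
  have hM : log (x * y / h) - log (D / sinh D) = M := by
    rw [← log_div (by positivity) (by positivity), hsinh]
    have : x * y / h / (D / (exp M * (h * D / (x * y)))) = exp M := by
      field_simp
    rw [this, log_exp]
  set S := log H - log (H - h) with hSdef
  have hS : 0 ≤ S := sub_nonneg.2 (log_le_log hHs (by linarith))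
  have hexpS : exp S = H / (H - h) := by
    rw [hSdef, exp_sub, exp_log hH0, exp_log hHs]
  have hcosh : cosh S - 1 = h / 2 := by
    rw [cosh_eq, exp_neg, hexpS]
    field_simp
    linear_combination -h * hHh
  have hsinhS : sinh S = H - h / 2 := by
    rw [sinh_eq, exp_neg, hexpS]
    field_simp
    linear_combination (h - 2 * H) * hHh
  have key := sinh_sub_self_le hD hE hS
  have hsqrt : √((cosh S - 1) ^ 2 + 2 * (cosh S - 1) * E + D ^ 2) = (x + y - h) / 2 := by
    have hyh : 0 < y - h := by
      have := mul_pos hy (exp_pos (r - x))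
      linarith
    rw [hcosh, ← sqrt_sq (show 0 ≤ (x + y - h) / 2 by linarith)]
    congr 1
    simp only [hEdef, hDdef]
    field_simp
    ring
  have hsum : h / 2 + E + (x + y - h) / 2 = x * y / h := by
    simp only [hEdef]
    ring
  rw [hsqrt, hcosh, hsum, hsinhS] at key
  linarith

/-- If `r < r2 < h`, then the equilibrium `ȳ` satisfies `ȳ < H*`, and the only positive
solution `(x, y)` of the system `y = y·exp(r − x) + h`, `x = x·exp(r − y) + h` is
`(ȳ, ȳ)`. -/
theorem ricker_stocking_unique_intersection_small_r (r h Hstar r2 ybar : ℝ)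
    (hh : 0 < h) (hr : 0 < r)
    (hH : Hstar = (h + Real.sqrt (h ^ 2 + 4 * h)) / 2)
    (hr2 : r2 = Hstar + Real.log (Hstar - h) - Real.log Hstar)
    (hrr2 : r < r2) (hr2h : r2 < h)
    (hybar : 0 < ybar) (heq : ybar = ybar * Real.exp (r - ybar) + h) :
    ybar < Hstar ∧
    ∀ x y : ℝ, 0 < x → 0 < y →
      y = y * Real.exp (r - x) + h → x = x * Real.exp (r - y) + h →
      x = ybar ∧ y = ybar := by
  have hsq : Real.sqrt (h ^ 2 + 4 * h) ^ 2 = h ^ 2 + 4 * h := Real.sq_sqrt (by positivity)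
  have hHh : Hstar * (Hstar - h) = h := by
    rw [hH]
    linear_combination hsq / 4
  have hlt : h < Hstar := by
    have : h < Real.sqrt (h ^ 2 + 4 * h) := Real.lt_sqrt_of_sq_lt (by linarith)
    linarith
  have hH0 : 0 < Hstar := hh.trans hlt
  have heq' : ybar * (1 - Real.exp (r - ybar)) = h := by linarith
  refine ⟨?_, fun x y hx hy h1 h2 => ?_⟩
  · have hexp : Real.exp (r2 - Hstar) = (Hstar - h) / Hstar := by
      have : r2 - Hstar = Real.log (Hstar - h) - Real.log Hstar := by linarith
      rw [this, Real.exp_sub, Real.exp_log (sub_pos.2 hlt), Real.exp_log hH0]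
    have hexp_lt : Real.exp (r - Hstar) < (Hstar - h) / Hstar :=
      hexp ▸ Real.exp_lt_exp.2 (by linarith)
    rw [lt_div_iff₀ hH0] at hexp_lt
    by_contra! hle
    rcases hle.eq_or_lt with rfl | hgt
    · linarith
    · have := stocking_lt_stocking (r := r) hH0 (by linarith) hgt
      linarith
  · have hxy : x = y := by
      rcases lt_trichotomy x y with hxy | hxy | hxy
      · linarith [le_of_offDiagonal_solution hh hlt hHh hx hxy h1 h2]
      · exact hxy
      · linarith [le_of_offDiagonal_solution hh hlt hHh hy hxy h2 h1]
    subst hxy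
    have hx' : x * (1 - Real.exp (r - x)) = h := by linarith
    have : x = ybar := by
      rcases lt_trichotomy x ybar with hlt' | heq'' | hgt
      · linarith [stocking_lt_stocking (r := r) hx (hx'.symm ▸ hh) hlt']
      · exact heq''
      · linarith [stocking_lt_stocking (r := r) hybar (heq'.symm ▸ hh) hgt]
    exact ⟨this, this⟩
end

section
/- Let h > 0 and r2 < r < h, where H* = (h + √(h² + 4h))/2 and r2 = H* + ln(H* − h) − ln(H*). Then the equilibrium ȳ (the positive solution of ȳ = ȳ·exp(r − ȳ) + h) satisfies H* < ȳ, and the system y = y·exp(r − x) + h, x = x·exp(r − y) + h has exactly three solutions with x, y > 0, namely (ȳ, ȳ), (x*, y*) and (y*, x*), for some reals 0 < x* < y*. -/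
open Real Set

/-- A function that vanishes at both ends of an interval cannot have a negative derivative at
each of its zeros there. -/
theorem not_zero_of_zero_of_deriv_neg {f f' : ℝ → ℝ} {a b : ℝ} (hab : a < b)
    (hf : ∀ x ∈ Icc a b, HasDerivAt f (f' x) x)
    (hneg : ∀ x ∈ Icc a b, f x = 0 → f' x < 0) (ha : f a = 0) : f b ≠ 0 := by
  intro hb
  have hle : ∀ ⦃x⦄, x ∈ Icc a b → f x ≤ 0 :=
    image_le_of_deriv_right_lt_deriv_boundary (B := fun _ => 0) (B' := fun _ => 0)
      (fun x hx => (hf x hx).continuousAt.continuousWithinAt)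
      (fun x hx => (hf x (Ico_subset_Icc_self hx)).hasDerivWithinAt) ha.le
      (fun x => hasDerivAt_const x 0) (fun x hx h0 => hneg x (Ico_subset_Icc_self hx) h0)
  have hbI : b ∈ Icc a b := right_mem_Icc.2 hab.le
  have hev := (hasDerivAt_iff_tendsto_slope_left_right.1 (hf b hbI)).1.eventually_lt_const
    (hneg b hbI hb)
  obtain ⟨x, hx, hxa⟩ := (hev.and (Ioo_mem_nhdsLT hab)).exists
  rw [slope_def_field, hb, div_neg_iff] at hx
  rcases hx with hx | hx
  · linarith [hx.1, hle (Ioo_subset_Icc_self hxa)]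
  · linarith [hx.2, hxa.2]

/-- A function with a zero of positive derivative at `a` is positive somewhere on `(a, b)`. -/
theorem exists_pos_of_deriv_pos {f : ℝ → ℝ} {a b d : ℝ} (hab : a < b)
    (hf : HasDerivAt f d a) (hd : 0 < d) (ha : f a = 0) : ∃ x ∈ Ioo a b, 0 < f x := by
  have hev := (hasDerivAt_iff_tendsto_slope_left_right.1 hf).2.eventually_const_lt hd
  obtain ⟨x, hx, hxa⟩ := (hev.and (Ioo_mem_nhdsGT hab)).exists
  refine ⟨x, hxa, ?_⟩
  rw [slope_def_field, ha, sub_zero] at hx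
  exact (div_pos_iff_of_pos_right (sub_pos.2 hxa.1)).1 hx

section Stocking

variable {r h x y : ℝ}

theorem lt_of_stocking (hy : 0 < y) (e : y = y * exp (r - x) + h) : h < y := by
  nlinarith [mul_pos hy (exp_pos (r - x))]

theorem stocking_iff_log (hh : 0 < h) (hy : h < y) :
    y = y * exp (r - x) + h ↔ x = r + log y - log (y - h) := by
  have hy0 : 0 < y := hh.trans hy
  have hyh : 0 < y - h := sub_pos.2 hy
  constructor
  · intro e
    have e' : y - h = y * exp (r - x) := by linarith
    rw [e', log_mul hy0.ne' (exp_pos _).ne', log_exp]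
    ring
  · intro e
    have e' : r - x = log (y - h) - log y := by linarith
    rw [e', exp_sub, exp_log hyh, exp_log hy0]
    field_simp
    ring

theorem one_sub_exp_pos (hy : r < y) : 0 < 1 - exp (r - y) := by
  have : exp (r - y) < 1 := exp_lt_one_iff.2 (by linarith)
  linarith

theorem stocking_iff_div (hy : r < y) :
    x = x * exp (r - y) + h ↔ x = h / (1 - exp (r - y)) := by
  rw [eq_div_iff (one_sub_exp_pos hy).ne']
  constructor <;> intro e <;> linarith

theorem stocking_div_lt_div {z : ℝ} (hh : 0 < h) (hy : r < y) (hyz : y < z) :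
    h / (1 - exp (r - z)) < h / (1 - exp (r - y)) := by
  have : exp (r - z) < exp (r - y) := exp_lt_exp.2 (by linarith)
  exact div_lt_div_of_pos_left hh (one_sub_exp_pos hy) (by linarith)

/-- At an off-diagonal solution the product of the slopes of the two curves is controlled; this
is the inequality between the geometric and logarithmic means, in the form `u < sinh u`. -/
theorem stocking_mul_lt_sq (hx : h < x) (hxy : x < y) (hh : 0 < h)
    (e₁ : y = y * exp (r - x) + h) (e₂ : x = x * exp (r - y) + h) :
    x * (x - h) * (y * (y - h)) < h ^ 2 := by
  set d := y - x with hd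
  have hd0 : 0 < d := sub_pos.2 hxy
  have hs : d / 2 < sinh (d / 2) := self_lt_sinh_iff.2 (by linarith)
  rw [sinh_eq] at hs
  have hx0 : 0 < x := hh.trans hx
  have hxh : 0 < x - h := sub_pos.2 hx
  have hyh : 0 < y - h := by linarith
  have hy0 : 0 < y := by linarith
  have hE : exp (r - x) = exp (r - y) * exp (d / 2) ^ 2 := by
    rw [pow_two, ← exp_add, ← exp_add]
    congr 1
    rw [hd]
    ring
  have hG : x * exp (r - y) = x - h := by linarith
  have key : y * (x - h) * exp (d / 2) ^ 2 = x * (y - h) := by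
    rw [← hG, mul_assoc, mul_assoc, mul_left_comm y x, ← hE]
    linear_combination (-x) * e₁
  rw [exp_neg] at hs
  set w := exp (d / 2)
  have hw : 0 < w := exp_pos _
  have h1 : d * w < w ^ 2 - 1 := by
    have : d * w < (w - w⁻¹) * w := by
      apply mul_lt_mul_of_pos_right _ hw
      linarith
    rwa [sub_mul w, inv_mul_cancel₀ hw.ne', ← pow_two] at this
  have hA : 0 < y * (x - h) := mul_pos hy0 hxh
  have h2 : y * (x - h) * w < h := by
    have h3 : d * (y * (x - h) * w) < d * h := by
      have := mul_lt_mul_of_pos_left h1 hA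
      have h4 : y * (x - h) * (w ^ 2 - 1) = d * h := by
        rw [mul_sub, key, hd]
        ring
      rw [h4] at this
      linarith
    exact lt_of_mul_lt_mul_left h3 hd0.le
  calc x * (x - h) * (y * (y - h)) = (y * (x - h) * w) ^ 2 := by
        linear_combination (-(y * (x - h))) * key
    _ < h ^ 2 := pow_lt_pow_left₀ h2 (mul_pos hA hw).le two_ne_zero

/-- The horizontal gap between the two curves at height `y`. -/
noncomputable def stockingGap (r h y : ℝ) : ℝ :=
  r + log y - log (y - h) - h / (1 - exp (r - y))

theorem hasDerivAt_stockingGap (hh : 0 < h) (hy : h < y) (hry : r < y) :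
    HasDerivAt (stockingGap r h)
      (h / (1 - exp (r - y)) * (h / (1 - exp (r - y)) - h) / h - h / (y * (y - h))) y := by
  have hy0 : y ≠ 0 := (hh.trans hy).ne'
  have hyh : y - h ≠ 0 := (sub_pos.2 hy).ne'
  have hE := (one_sub_exp_pos hry).ne'
  have h1 := (hasDerivAt_log hy0).const_add r
  have h2 := ((hasDerivAt_id y).sub_const h).log hyh
  have h3 := (((hasDerivAt_id y).const_sub r).exp.const_sub 1)
  have h4 := (hasDerivAt_const y h).div h3 hE
  refine ((h1.sub h2).sub h4).congr_deriv ?_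
  simp only [id]
  field_simp
  ring

theorem stockingGap_eq_zero_iff (hh : 0 < h) (hy : h < y) :
    stockingGap r h y = 0 ↔
      y = y * exp (r - h / (1 - exp (r - y))) + h := by
  rw [stocking_iff_log hh hy, stockingGap, sub_eq_zero, eq_comm]

theorem lt_stocking_div (hh : 0 < h) (hry : r < y) : h < h / (1 - exp (r - y)) := by
  rw [lt_div_iff₀ (one_sub_exp_pos hry)]
  nlinarith [exp_pos (r - y)]

theorem exists_stockingGap_neg (hh : 0 < h) (hrh : r < h) (a : ℝ) :
    ∃ y, a < y ∧ stockingGap r h y < 0 := by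
  have hE := one_sub_exp_pos hrh
  obtain ⟨y, hy⟩ := exists_gt (max a (h / (1 - exp (r - h))))
  obtain ⟨hay, hhy⟩ := max_lt_iff.1 hy
  have hy' : h < y := (lt_stocking_div hh hrh).trans hhy
  have hy0 : 0 < y := hh.trans hy'
  refine ⟨y, hay, ?_⟩
  have h1 : log (exp (r - h) * y) < log (y - h) := by
    apply log_lt_log (mul_pos (exp_pos _) hy0)
    rw [div_lt_iff₀ hE] at hhy
    linarith
  rw [log_mul (exp_pos _).ne' hy0.ne', log_exp] at h1
  have h2 := lt_stocking_div hh (hrh.trans hy')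
  rw [stockingGap]
  linarith

theorem lt_of_stocking_equilibrium {ybar : ℝ} (hh : 0 < h) (hx : h < x) (hy : h < ybar)
    (heq : ybar = ybar * exp (r - ybar) + h) (hlt : x + log (x - h) - log x < r) :
    x < ybar := by
  rw [stocking_iff_log hh hy] at heq
  by_contra! hle
  have hx0 : 0 < x := hh.trans hx
  have hy0 : 0 < ybar := hh.trans hy
  have h1 : log ((ybar - h) * x) ≤ log ((x - h) * ybar) := by
    apply log_le_log (mul_pos (sub_pos.2 hy) hx0)
    nlinarith
  rw [log_mul (sub_pos.2 hy).ne' hx0.ne', log_mul (sub_pos.2 hx).ne' hy0.ne'] at h1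
  linarith

/-- An off-diagonal solution straddles the equilibrium. -/
theorem equilibrium_lt_of_stocking {ybar : ℝ} (hh : 0 < h) (hrh : r < h) (hy : h < y)
    (hxy : x < y) (hyb : h < ybar) (heq : ybar = ybar * exp (r - ybar) + h)
    (e₂ : x = x * exp (r - y) + h) : ybar < y := by
  rw [stocking_iff_div (hrh.trans hyb)] at heq
  rw [stocking_iff_div (hrh.trans hy)] at e₂
  by_contra! hle
  rcases hle.eq_or_lt with h1 | h1
  · subst h1
    linarith
  · have := stocking_div_lt_div hh (hrh.trans hy) h1
    linarith

theorem stocking_equilibrium_unique {ybar : ℝ} (hh : 0 < h) (hrh : r < h) (hy : h < y)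
    (hyb : h < ybar) (heq : ybar = ybar * exp (r - ybar) + h)
    (e : y = y * exp (r - y) + h) : y = ybar := by
  rw [stocking_iff_div (hrh.trans hyb)] at heq
  rw [stocking_iff_div (hrh.trans hy)] at e
  rcases lt_trichotomy y ybar with h1 | h1 | h1
  · have := stocking_div_lt_div hh (hrh.trans hy) h1
    linarith
  · exact h1
  · have := stocking_div_lt_div hh (hrh.trans hyb) h1
    linarith

/-- Above the equilibrium the gap has at most one zero. -/
theorem stockingGap_zero_unique {ybar z : ℝ} (hh : 0 < h) (hrh : r < h) (hyb : h < ybar)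
    (heq : ybar = ybar * exp (r - ybar) + h) (hy : ybar < y) (hyz : y < z)
    (h0 : stockingGap r h y = 0) : stockingGap r h z ≠ 0 := by
  refine not_zero_of_zero_of_deriv_neg hyz (fun w hw => hasDerivAt_stockingGap hh
    (by linarith [hw.1]) (by linarith [hw.1])) (fun w hw hw0 => ?_) h0
  have hbw : ybar < w := hy.trans_le hw.1
  have hhw : h < w := hyb.trans hbw
  have hrw : r < w := hrh.trans hhw
  rw [stockingGap_eq_zero_iff hh hhw] at hw0
  rw [stocking_iff_div (hrh.trans hyb)] at heq
  have hlt := stocking_div_lt_div hh (hrh.trans hyb) hbw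
  have hx := lt_stocking_div hh hrw
  have e₂ := (stocking_iff_div (x := h / (1 - exp (r - w))) hrw).2 rfl
  have key := stocking_mul_lt_sq hx (by linarith) hh hw0 e₂
  have hw' : 0 < w * (w - h) := mul_pos (hh.trans hhw) (sub_pos.2 hhw)
  rw [sub_neg, div_lt_div_iff₀ hh hw']
  linarith

theorem exists_stockingGap_zero {ybar : ℝ} (hh : 0 < h) (hrh : r < h) (hyb : h < ybar)
    (heq : ybar = ybar * exp (r - ybar) + h) (hlarge : h < ybar * (ybar - h)) :
    ∃ y, ybar < y ∧ stockingGap r h y = 0 := by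
  have hrb := hrh.trans hyb
  obtain ⟨c, hc, hcneg⟩ := exists_stockingGap_neg hh hrh ybar
  have hdiv := (stocking_iff_div hrb).1 heq
  have h0 : stockingGap r h ybar = 0 := by
    rw [stockingGap_eq_zero_iff hh hyb, ← hdiv]
    exact heq
  have hder := hasDerivAt_stockingGap hh hyb hrb
  rw [← hdiv] at hder
  obtain ⟨b, hb, hbpos⟩ := exists_pos_of_deriv_pos hc hder (by
    rw [sub_pos, div_lt_div_iff₀ (hh.trans hlarge) hh]
    nlinarith) h0
  have hcont : ContinuousOn (stockingGap r h) (Icc b c) := fun w hw =>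
    (hasDerivAt_stockingGap hh (by linarith [hw.1, hb.1])
      (by linarith [hw.1, hb.1])).continuousAt.continuousWithinAt
  obtain ⟨y, hy, hy0⟩ := intermediate_value_Icc' hb.2.le hcont ⟨hcneg.le, hbpos.le⟩
  exact ⟨y, hb.1.trans_le hy.1, hy0⟩

end Stocking

/-- If `r2 < r < h`, then the equilibrium `ȳ` satisfies `H* < ȳ`, and the system
`y = y·exp(r − x) + h`, `x = x·exp(r − y) + h` has exactly three positive solutions:
`(ȳ, ȳ)`, `(x*, y*)` and `(y*, x*)` with `0 < x* < y*`. -/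
theorem ricker_stocking_three_intersections (r h Hstar r2 ybar : ℝ)
    (hh : 0 < h) (hr : 0 < r)
    (hH : Hstar = (h + Real.sqrt (h ^ 2 + 4 * h)) / 2)
    (hr2 : r2 = Hstar + Real.log (Hstar - h) - Real.log Hstar)
    (hr2r : r2 < r) (hrh : r < h)
    (hybar : 0 < ybar) (heq : ybar = ybar * Real.exp (r - ybar) + h) :
    Hstar < ybar ∧
    ∃ xs ys : ℝ, 0 < xs ∧ xs < ys ∧
      {p : ℝ × ℝ | 0 < p.1 ∧ 0 < p.2 ∧
          p.2 = p.2 * Real.exp (r - p.1) + h ∧ p.1 = p.1 * Real.exp (r - p.2) + h} =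
        {(ybar, ybar), (xs, ys), (ys, xs)} := by
  have hyb : h < ybar := lt_of_stocking hybar heq
  have hsq : Real.sqrt (h ^ 2 + 4 * h) ^ 2 = h ^ 2 + 4 * h := Real.sq_sqrt (by positivity)
  have hsq0 : h < Real.sqrt (h ^ 2 + 4 * h) := Real.lt_sqrt_of_sq_lt (by linarith)
  have hHh : h < Hstar := by linarith
  have hHeq : Hstar * (Hstar - h) = h := by
    rw [hH]
    linear_combination hsq / 4
  have hHy : Hstar < ybar := lt_of_stocking_equilibrium hh hHh hyb heq (hr2 ▸ hr2r)
  have hlarge : h < ybar * (ybar - h) := by nlinarith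
  refine ⟨hHy, ?_⟩
  obtain ⟨ys, hys, hgap⟩ := exists_stockingGap_zero hh hrh hyb heq hlarge
  have hhys := hyb.trans hys
  have hrys := hrh.trans hhys
  have hxs := lt_stocking_div hh hrys
  have hxlt := stocking_div_lt_div hh (hrh.trans hyb) hys
  rw [← (stocking_iff_div (hrh.trans hyb)).1 heq] at hxlt
  have e₁ := (stockingGap_eq_zero_iff hh hhys).1 hgap
  have e₂ := (stocking_iff_div (x := h / (1 - exp (r - ys))) hrys).2 rfl
  have huniq : ∀ x y : ℝ, 0 < y → x < y → y = y * exp (r - x) + h →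
      x = x * exp (r - y) + h → x = h / (1 - exp (r - ys)) ∧ y = ys := by
    intro x y hy hxy f₁ f₂
    have hhy := lt_of_stocking hy f₁
    have hby := equilibrium_lt_of_stocking hh hrh hhy hxy hyb heq f₂
    rw [stocking_iff_div (hrh.trans hhy)] at f₂
    have hg : stockingGap r h y = 0 := by
      rw [stockingGap_eq_zero_iff hh hhy, ← f₂]
      exact f₁
    have hyy : y = ys := by
      rcases lt_trichotomy y ys with h1 | h1 | h1
      · exact absurd hgap (stockingGap_zero_unique hh hrh hyb heq hby h1 hg)
      · exact h1
      · exact absurd hg (stockingGap_zero_unique hh hrh hyb heq hys h1 hgap)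
    exact ⟨hyy ▸ f₂, hyy⟩
  refine ⟨h / (1 - exp (r - ys)), ys, hh.trans hxs, hxlt.trans hys, ?_⟩
  ext ⟨x, y⟩
  simp only [mem_ofPred_eq, mem_insert_iff, mem_singleton_iff, Prod.mk.injEq]
  constructor
  · rintro ⟨hx, hy, f₁, f₂⟩
    rcases lt_trichotomy x y with h1 | h1 | h1
    · exact Or.inr (Or.inl (huniq x y hy h1 f₁ f₂))
    · subst h1
      have := stocking_equilibrium_unique hh hrh (lt_of_stocking hy f₁) hyb heq f₁
      exact Or.inl ⟨this, this⟩
    · exact Or.inr (Or.inr (huniq y x hx h1 f₂ f₁).symm)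
  · have hx0 := hh.trans hxs
    have hy0 := hh.trans hhys
    rintro (⟨h1, h2⟩ | ⟨h1, h2⟩ | ⟨h1, h2⟩) <;> rw [h1, h2]
    · exact ⟨hybar, hybar, heq, heq⟩
    · exact ⟨hx0, hy0, e₁, e₂⟩
    · exact ⟨hy0, hx0, e₂, e₁⟩
end

section
/- Let h > 0 and 0 < r ≤ r2, where H* = (h + √(h² + 4h))/2 and r2 = H* + ln(H* − h) − ln(H*). Then the equilibrium ȳ is globally asymptotically stable: for every sequence (y_n) with y_0, y_1 ≥ 0 and y_{n+2} = y_{n+1}·exp(r − y_n) + h for all n ≥ 0, the sequence y_n converges to ȳ. -/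
open Filter Topology

/-- The Padé bound `exp t < (2 + t) / (2 - t)`, cleared of denominators. -/
lemma two_sub_mul_exp_lt {t : ℝ} (ht : 0 < t) : (2 - t) * Real.exp t < 2 + t := by
  have hmono : StrictMonoOn (fun x : ℝ => 2 + x - (2 - x) * Real.exp x) (Set.Ici 0) := by
    refine strictMonoOn_of_deriv_pos (convex_Ici 0) (by fun_prop) fun x hx => ?_
    rw [interior_Ici] at hx
    have hx : 0 < x := hx
    have hd : HasDerivAt (fun x : ℝ => 2 + x - (2 - x) * Real.exp x)
        (1 - (-1 * Real.exp x + (2 - x) * Real.exp x)) x :=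
      ((hasDerivAt_id x).const_add 2).sub
        (((hasDerivAt_id x).const_sub 2).mul (Real.hasDerivAt_exp x))
    rw [hd.deriv]
    have h1 : -x + 1 < Real.exp (-x) := Real.add_one_lt_exp (by linarith)
    have h2 : Real.exp (-x) * Real.exp x = 1 := by rw [← Real.exp_add]; simp
    nlinarith [Real.exp_pos x]
  have := hmono (Set.mem_Ici.2 le_rfl) (Set.mem_Ici.2 ht.le) ht
  simp only [Real.exp_zero] at this
  linarith

/-- With `s = Hstar - h`, one has `h = s / (1 - s) - s` and `r2 = s / (1 - s) + log (1 - s)`;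
the threshold is therefore smaller than the stocking rate. -/
lemma threshold_lt_stocking {h H : ℝ} (hh : 0 < h) (hH : 0 < H) (hsq : H * (H - h) = h) :
    H + Real.log (H - h) - Real.log H < h := by
  have hs : 0 < H - h := by by_contra hc; nlinarith
  have hq : (H - h) / H = 1 - (H - h) := by
    field_simp; linarith
  have hpos : 0 < (H - h) / H := div_pos hs hH
  have := Real.log_lt_sub_one_of_pos hpos (by rw [hq]; linarith)
  rw [Real.log_div hs.ne' hH.ne', hq] at this
  linarith

/-- Below the threshold the equilibrium lies to the left of `H`. -/
lemma equilibrium_le {r h H x : ℝ} (hh : 0 < h) (hH : 0 < H) (hs : 0 < H - h)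
    (hr : r ≤ H + Real.log (H - h) - Real.log H) (hx : 0 < x)
    (heq : x = x * Real.exp (r - x) + h) : x ≤ H := by
  by_contra! hlt
  have hxh : 0 < x - h := by nlinarith [mul_pos hx (Real.exp_pos (r - x))]
  have hexp : Real.exp (r - x) < (H - h) / H := by
    rw [← Real.lt_log_iff_exp_lt (div_pos hs hH), Real.log_div hs.ne' hH.ne']
    linarith
  rw [lt_div_iff₀ hH] at hexp
  nlinarith

/-- A pair `m ≤ M` which the map `(m, M) ↦ (m * exp (r - M) + h, M * exp (r - m) + h)` widens
reduces to the equilibrium. -/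
lemma eq_equilibrium_of_widening {r h x m M : ℝ} (hh : 0 < h) (hx : 0 < x)
    (heq : x = x * Real.exp (r - x) + h) (hxH : x * (x - h) ≤ h) (hrm : r < m) (hm : 0 < m)
    (hmM : m ≤ M) (hM : M ≤ M * Real.exp (r - m) + h) (hm' : m * Real.exp (r - M) + h ≤ m) :
    m = x ∧ M = x := by
  have hmx : m ≤ x := by
    by_contra! hc
    have h1 : Real.exp (r - m) < Real.exp (r - x) := Real.exp_lt_exp.2 (by linarith)
    have h2 : Real.exp (r - m) < 1 := Real.exp_lt_one_iff.2 (by linarith)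
    nlinarith
  have hxM : x ≤ M := by
    by_contra! hc
    have h1 : Real.exp (r - x) < Real.exp (r - M) := Real.exp_lt_exp.2 (by linarith)
    have h2 : Real.exp (r - x) < 1 := Real.exp_lt_one_iff.2 (by linarith)
    nlinarith
  obtain ⟨α, rfl⟩ : ∃ α, m = x - α := ⟨x - m, by ring⟩
  obtain ⟨β, rfl⟩ : ∃ β, M = x + β := ⟨M - x, by ring⟩
  have hα : 0 ≤ α := by linarith
  have hβ : 0 ≤ β := by linarith
  rw [show r - (x - α) = (r - x) + α by ring, Real.exp_add] at hM
  rw [show r - (x + β) = (r - x) + -β by ring, Real.exp_add] at hm'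
  have hu : 0 < Real.exp (r - x) := Real.exp_pos _
  have hE : 1 ≤ Real.exp α := Real.one_le_exp hα
  have hF : Real.exp (-β) ≤ 1 := Real.exp_le_one_iff.2 (by linarith)
  have hFE : Real.exp (-β) * Real.exp β = 1 := by rw [← Real.exp_add]; simp
  have hPα : 0 < α → (Real.exp α - 1) * (2 - α) < 2 * α := fun h0 => by
    linarith [two_sub_mul_exp_lt h0]
  have hPβ : 0 < β → (1 - Real.exp (-β)) * (2 + β) < 2 * β := fun h0 => by
    have := mul_lt_mul_of_pos_left (two_sub_mul_exp_lt h0) (Real.exp_pos (-β))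
    nlinarith
  generalize Real.exp (r - x) = u at *
  have ha : 0 ≤ Real.exp α - 1 := by linarith
  have hb : 0 ≤ 1 - Real.exp (-β) := by linarith
  have hαz : α = 0 → Real.exp α - 1 = 0 := by rintro rfl; simp
  have hβz : β = 0 → 1 - Real.exp (-β) = 0 := by rintro rfl; simp
  obtain ⟨a, haE⟩ : ∃ a, a = Real.exp α - 1 := ⟨_, rfl⟩
  obtain ⟨b, hbF⟩ : ∃ b, b = 1 - Real.exp (-β) := ⟨_, rfl⟩
  rw [show Real.exp α = 1 + a by linarith] at hM
  rw [show Real.exp (-β) = 1 - b by linarith] at hm'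
  rw [← haE] at hPα ha hαz
  rw [← hbF] at hPβ hb hβz
  have hv : 0 < 1 - u := by by_contra hc; nlinarith
  have hxu : x * u ≤ 1 - u := by
    have : h = x * (1 - u) := by linarith
    subst this
    nlinarith
  have h1 : β * (1 - u - u * a) ≤ (1 - u) * a := by
    nlinarith [mul_le_mul_of_nonneg_right hxu ha]
  have h2 : α * (1 - u + u * b) ≤ (1 - u) * b := by
    nlinarith [mul_le_mul_of_nonneg_right hxu hb]
  rcases hα.eq_or_lt with h0 | hα
  · have := hαz h0.symm
    rw [this] at h1
    have : β ≤ 0 := by by_contra! hc; nlinarith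
    constructor <;> linarith
  rcases hβ.eq_or_lt with h0 | hβ
  · have := hβz h0.symm
    rw [this] at h2
    nlinarith
  exfalso
  specialize hPα hα
  specialize hPβ hβ
  generalize 1 - u = v at *
  have hαu : α * u < v := by
    by_contra! hc
    nlinarith [mul_le_mul_of_nonneg_right hc hb, mul_pos hα hv]
  have h3 : α * (2 * v + β * (v + 2 * u)) < 2 * v * β := by
    nlinarith [mul_lt_mul_of_pos_left hPβ (sub_pos.2 hαu)]
  have hα2 : α < 2 := by
    by_contra! hc
    nlinarith [mul_pos hv hβ, mul_pos hα hv, mul_pos (mul_pos hα hu) hβ]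
  nlinarith [mul_lt_mul_of_pos_left hPα (show 0 < v + u * β by positivity),
    mul_le_mul_of_nonneg_left h1 (sub_pos.2 hα2).le]

/-- The recursion widens the interval between the limits inferior and superior of an orbit. -/
lemma limsup_liminf_widening {r h : ℝ} {y : ℕ → ℝ} (hy : ∀ n, 0 ≤ y n)
    (hrec : ∀ n, y (n + 2) = y (n + 1) * Real.exp (r - y n) + h)
    (hb : IsBoundedUnder (· ≤ ·) atTop y) (hb' : IsBoundedUnder (· ≥ ·) atTop y) :
    limsup y atTop ≤ limsup y atTop * Real.exp (r - liminf y atTop) + h ∧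
      liminf y atTop * Real.exp (r - limsup y atTop) + h ≤ liminf y atTop := by
  set M := limsup y atTop
  set m := liminf y atTop
  have hup : ∀ ε > 0, ∀ᶠ n in atTop, y n < M + ε := fun ε hε =>
    eventually_lt_of_limsup_lt (by linarith) hb
  have hlo : ∀ ε > 0, ∀ᶠ n in atTop, m - ε < y n := fun ε hε =>
    eventually_lt_of_lt_liminf (by linarith) hb'
  have hshift (p : ℝ → Prop) (hp : ∀ᶠ n in atTop, p (y (n + 2))) : ∀ᶠ n in atTop, p (y n) := by
    rw [← map_add_atTop_eq_nat 2]
    exact hp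
  have hpos : (𝓝[>] (0 : ℝ)) ≤ 𝓝 0 := nhdsWithin_le_nhds
  constructor
  · have hlim : Tendsto (fun ε : ℝ => (M + ε) * Real.exp (r - (m - ε)) + h) (𝓝[>] 0)
        (𝓝 (M * Real.exp (r - m) + h)) := by
      have : Continuous fun ε : ℝ => (M + ε) * Real.exp (r - (m - ε)) + h := by fun_prop
      simpa using (this.tendsto 0).mono_left hpos
    refine ge_of_tendsto hlim ?_
    filter_upwards [self_mem_nhdsWithin] with ε hε
    refine limsup_le_of_le hb'.isCoboundedUnder_le ?_
    refine hshift (· ≤ _) ?_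
    filter_upwards [hlo ε hε, (tendsto_add_atTop_nat 1).eventually (hup ε hε)] with n h1 h2
    have hE : Real.exp (r - y n) ≤ Real.exp (r - (m - ε)) := Real.exp_le_exp.2 (by linarith)
    have := mul_le_mul h2.le hE (Real.exp_pos _).le ((hy _).trans h2.le)
    rw [hrec]
    linarith
  · have hlim : Tendsto (fun ε : ℝ => (m - ε) * Real.exp (r - (M + ε)) + h) (𝓝[>] 0)
        (𝓝 (m * Real.exp (r - M) + h)) := by
      have : Continuous fun ε : ℝ => (m - ε) * Real.exp (r - (M + ε)) + h := by fun_prop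
      simpa using (this.tendsto 0).mono_left hpos
    refine le_of_tendsto hlim ?_
    filter_upwards [self_mem_nhdsWithin] with ε hε
    refine le_liminf_of_le hb.isCoboundedUnder_ge ?_
    refine hshift (_ ≤ ·) ?_
    filter_upwards [hup ε hε, (tendsto_add_atTop_nat 1).eventually (hlo ε hε)] with n h1 h2
    have hE : Real.exp (r - (M + ε)) ≤ Real.exp (r - y n) := Real.exp_le_exp.2 (by linarith)
    have := mul_le_mul h2.le hE (Real.exp_pos _).le (hy _)
    rw [hrec]
    linarith

/-- If `0 < r ≤ r2`, then the equilibrium `ȳ` of the Ricker model with delay and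
constant stocking is globally asymptotically stable: every orbit with nonnegative
initial conditions converges to `ȳ`. -/
theorem ricker_stocking_global_stability (r h Hstar r2 ybar : ℝ)
    (hh : 0 < h) (hr : 0 < r)
    (hH : Hstar = (h + Real.sqrt (h ^ 2 + 4 * h)) / 2)
    (hr2 : r2 = Hstar + Real.log (Hstar - h) - Real.log Hstar)
    (hrr2 : r ≤ r2)
    (hybar : 0 < ybar) (heq : ybar = ybar * Real.exp (r - ybar) + h)
    (y : ℕ → ℝ) (hy0 : 0 ≤ y 0) (hy1 : 0 ≤ y 1)
    (hrec : ∀ n : ℕ, y (n + 2) = y (n + 1) * Real.exp (r - y n) + h) :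
    Filter.Tendsto y Filter.atTop (nhds ybar) := by
  have hroot : Real.sqrt (h ^ 2 + 4 * h) ^ 2 = h ^ 2 + 4 * h := Real.sq_sqrt (by positivity)
  have hHpos : 0 < Hstar := by rw [hH]; positivity
  have hsq : Hstar * (Hstar - h) = h := by rw [hH]; linarith
  have hs : 0 < Hstar - h := by by_contra hc; nlinarith
  have hrh : r < h := by
    have := threshold_lt_stocking hh hHpos hsq
    linarith
  have hyH : ybar ≤ Hstar := equilibrium_le hh hHpos hs (hr2 ▸ hrr2) hybar heq
  have hxH : ybar * (ybar - h) ≤ h := by nlinarith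
  have hnn : ∀ n, 0 ≤ y n ∧ 0 ≤ y (n + 1) := by
    intro n
    induction n with
    | zero => exact ⟨hy0, hy1⟩
    | succ k ih =>
      refine ⟨ih.2, ?_⟩
      rw [hrec]
      have := mul_nonneg ih.2 (Real.exp_pos (r - y k)).le
      linarith
  have hyh : ∀ n, h ≤ y (n + 2) := fun n => by
    rw [hrec]
    have := mul_nonneg (hnn n).2 (Real.exp_pos (r - y n)).le
    linarith
  have hq : Real.exp (r - h) < 1 := Real.exp_lt_one_iff.2 (by linarith)
  obtain ⟨C, hC2, hC3, hC⟩ : ∃ C, y 2 ≤ C ∧ y 3 ≤ C ∧ C * Real.exp (r - h) + h ≤ C := by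
    refine ⟨max (max (y 2) (y 3)) (h / (1 - Real.exp (r - h))), by simp, by simp, ?_⟩
    have := (div_le_iff₀ (sub_pos.2 hq)).1
      (le_max_right (max (y 2) (y 3)) (h / (1 - Real.exp (r - h))))
    linarith
  have hyC : ∀ n, y (n + 2) ≤ C ∧ y (n + 3) ≤ C := by
    intro n
    induction n with
    | zero => exact ⟨hC2, hC3⟩
    | succ k ih =>
      refine ⟨ih.2, ?_⟩
      rw [show k + 1 + 3 = (k + 2) + 2 by ring, hrec]
      refine le_trans ?_ hC
      have hE : Real.exp (r - y (k + 2)) ≤ Real.exp (r - h) :=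
        Real.exp_le_exp.2 (by linarith [hyh k])
      have := mul_le_mul ih.2 hE (Real.exp_pos _).le (le_trans hh.le ((hyh k).trans ih.1))
      linarith
  have hle : ∀ᶠ n in atTop, y n ≤ C := by
    filter_upwards [eventually_ge_atTop 2] with n hn
    obtain ⟨k, rfl⟩ := Nat.exists_eq_add_of_le' hn
    exact (hyC k).1
  have hge : ∀ᶠ n in atTop, h ≤ y n := by
    filter_upwards [eventually_ge_atTop 2] with n hn
    obtain ⟨k, rfl⟩ := Nat.exists_eq_add_of_le' hn
    exact hyh k
  have hb : IsBoundedUnder (· ≤ ·) atTop y := ⟨C, hle⟩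
  have hb' : IsBoundedUnder (· ≥ ·) atTop y := ⟨h, hge⟩
  obtain ⟨hM, hm⟩ := limsup_liminf_widening (fun n => (hnn n).1) hrec hb hb'
  have hhm : h ≤ liminf y atTop := le_liminf_of_le hb.isCoboundedUnder_ge hge
  obtain ⟨h1, h2⟩ := eq_equilibrium_of_widening hh hybar heq hxH (hrh.trans_le hhm)
    (hh.trans_le hhm) (liminf_le_limsup hb hb') hM hm
  exact tendsto_of_liminf_eq_limsup h1 h2 hb hb'
end

section
/- Let h > 0 and r2 < r < h, where H* = (h + √(h² + 4h))/2 and r2 = H* + ln(H* − h) − ln(H*), and let 0 < x* < y* satisfy x* = x*·exp(r − y*) + h and y* = y*·exp(r − x*) + h. Then for every sequence (y_n) with y_0, y_1 ≥ 0 and y_{n+2} = y_{n+1}·exp(r − y_n) + h for all n ≥ 0, one has x* ≤ liminf y_n ≤ limsup y_n ≤ y*; i.e., the box [x*, y*]² is an absorbing region. -/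
open Filter Topology

/-- The value `x` solving `x = x * exp (r - s) + h`. -/
noncomputable def pseudoPartner (r h s : ℝ) : ℝ := h / (1 - Real.exp (r - s))

theorem one_sub_exp_pos_s12 {r s : ℝ} (hs : r < s) : 0 < 1 - Real.exp (r - s) := by
  have : Real.exp (r - s) < 1 := Real.exp_zero ▸ Real.exp_lt_exp.2 (by linarith)
  linarith

theorem eq_pseudoPartner_iff {r h s x : ℝ} (hs : r < s) :
    x = pseudoPartner r h s ↔ x = x * Real.exp (r - s) + h := by
  rw [pseudoPartner, eq_div_iff (one_sub_exp_pos_s12 hs).ne']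
  constructor <;> intro H <;> linarith

theorem le_pseudoPartner_iff {r h s x : ℝ} (hs : r < s) :
    x ≤ pseudoPartner r h s ↔ x ≤ x * Real.exp (r - s) + h := by
  rw [pseudoPartner, le_div_iff₀ (one_sub_exp_pos_s12 hs)]
  constructor <;> intro H <;> linarith

theorem pseudoPartner_le_iff {r h s x : ℝ} (hs : r < s) :
    pseudoPartner r h s ≤ x ↔ x * Real.exp (r - s) + h ≤ x := by
  rw [pseudoPartner, div_le_iff₀ (one_sub_exp_pos_s12 hs)]
  constructor <;> intro H <;> linarith

theorem lt_pseudoPartner {r h s : ℝ} (hh : 0 < h) (hs : r < s) : h < pseudoPartner r h s := by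
  rw [pseudoPartner, lt_div_iff₀ (one_sub_exp_pos_s12 hs)]
  nlinarith [Real.exp_pos (r - s)]

theorem pseudoPartner_lt_pseudoPartner {r h s t : ℝ} (hh : 0 < h) (hs : r < s) (hst : s < t) :
    pseudoPartner r h t < pseudoPartner r h s := by
  have : Real.exp (r - t) < Real.exp (r - s) := Real.exp_lt_exp.2 (by linarith)
  exact div_lt_div_of_pos_left hh (one_sub_exp_pos_s12 hs) (by linarith)

theorem pseudoPartner_le_pseudoPartner {r h s t : ℝ} (hh : 0 < h) (hs : r < s) (hst : s ≤ t) :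
    pseudoPartner r h t ≤ pseudoPartner r h s := by
  rcases hst.eq_or_lt with rfl | hst
  · exact le_rfl
  · exact (pseudoPartner_lt_pseudoPartner hh hs hst).le

theorem continuousOn_pseudoPartner (r h : ℝ) :
    ContinuousOn (pseudoPartner r h) (Set.Ioi r) := by
  unfold pseudoPartner
  exact ContinuousOn.div (by fun_prop) (by fun_prop) fun s hs => (one_sub_exp_pos_s12 hs).ne'

theorem sinh_le_self_mul_cosh {t : ℝ} (ht : 0 ≤ t) : Real.sinh t ≤ t * Real.cosh t := by
  have hmono : MonotoneOn (fun t : ℝ => t * Real.cosh t - Real.sinh t) (Set.Ici 0) := by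
    apply monotoneOn_of_deriv_nonneg (convex_Ici 0) (by fun_prop) (by fun_prop)
    intro x hx
    rw [interior_Ici] at hx
    have hd : HasDerivAt (fun t : ℝ => t * Real.cosh t - Real.sinh t)
        (1 * Real.cosh x + x * Real.sinh x - Real.cosh x) x :=
      ((hasDerivAt_id x).mul (Real.hasDerivAt_cosh x)).sub (Real.hasDerivAt_sinh x)
    rw [hd.deriv]
    have := mul_pos hx (Real.sinh_pos_iff.2 hx)
    linarith
  have := hmono Set.self_mem_Ici ht ht
  simp only [zero_mul, Real.sinh_zero, sub_zero] at this
  linarith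

/-- The function `sinh t / t` is supermultiplicative on the positive reals. -/
theorem add_mul_sinh_mul_sinh_le {a b : ℝ} (ha : 0 < a) (hb : 0 < b) :
    (a + b) * (Real.sinh a * Real.sinh b) ≤ a * b * Real.sinh (a + b) := by
  rw [Real.sinh_add]
  have h1 := mul_le_mul_of_nonneg_left (sinh_le_self_mul_cosh ha.le)
    (mul_pos hb (Real.sinh_pos_iff.2 hb)).le
  have h2 := mul_le_mul_of_nonneg_left (sinh_le_self_mul_cosh hb.le)
    (mul_pos ha (Real.sinh_pos_iff.2 ha)).le
  linarith

theorem mul_sinh_mul_sinh_lt {a b m : ℝ} (ha : 0 < a) (hb : 0 < b) (hm : 0 < m) :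
    m * (a + b + m) * (Real.sinh a * Real.sinh b) <
      a * b * (Real.sinh m * Real.sinh (a + b + m)) := by
  have h1 := add_mul_sinh_mul_sinh_le ha hb
  have h2 := add_mul_sinh_mul_sinh_le (add_pos ha hb) hm
  have hsm : m < Real.sinh m := Real.self_lt_sinh_iff.2 hm
  have hs := Real.sinh_pos_iff.2 (add_pos (add_pos ha hb) hm)
  have hs' := Real.sinh_pos_iff.2 (add_pos ha hb)
  have h3 : (a + b + m) * Real.sinh (a + b) ≤ (a + b) * Real.sinh (a + b + m) := by
    refine le_of_mul_le_mul_right ?_ hm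
    calc (a + b + m) * Real.sinh (a + b) * m
        ≤ (a + b + m) * Real.sinh (a + b) * Real.sinh m := by gcongr
      _ ≤ (a + b) * Real.sinh (a + b + m) * m := by linarith
  have h4 : (a + b + m) * (Real.sinh a * Real.sinh b) ≤ a * b * Real.sinh (a + b + m) := by
    refine le_of_mul_le_mul_right ?_ (add_pos ha hb)
    calc (a + b + m) * (Real.sinh a * Real.sinh b) * (a + b)
        = (a + b + m) * ((a + b) * (Real.sinh a * Real.sinh b)) := by ring
      _ ≤ (a + b + m) * (a * b * Real.sinh (a + b)) := by gcongr
      _ = a * b * ((a + b + m) * Real.sinh (a + b)) := by ring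
      _ ≤ a * b * ((a + b) * Real.sinh (a + b + m)) := by gcongr
      _ = a * b * Real.sinh (a + b + m) * (a + b) := by ring
  calc m * (a + b + m) * (Real.sinh a * Real.sinh b)
      = m * ((a + b + m) * (Real.sinh a * Real.sinh b)) := by ring
    _ ≤ m * (a * b * Real.sinh (a + b + m)) := by gcongr
    _ < Real.sinh m * (a * b * Real.sinh (a + b + m)) := by gcongr
    _ = a * b * (Real.sinh m * Real.sinh (a + b + m)) := by ring

theorem exp_sub_exp_eq_sinh (r a b : ℝ) :
    Real.exp (r - a) - Real.exp (r - b) =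
      2 * Real.exp (r - (a + b) / 2) * Real.sinh ((b - a) / 2) := by
  rw [Real.sinh_eq]
  have e1 : r - a = (r - (a + b) / 2) + (b - a) / 2 := by ring
  have e2 : r - b = (r - (a + b) / 2) + -((b - a) / 2) := by ring
  rw [e1, e2, Real.exp_add, Real.exp_add]
  ring

/-- Two distinct pairs of pseudo fixed points cannot be nested. -/
theorem not_nested_pseudo_fixed_points {r h x₁ y₁ x₂ y₂ : ℝ} (hh : 0 < h) (hx₂ : 0 < x₂)
    (hx : x₂ < x₁) (hxy : x₁ < y₁) (hy : y₁ < y₂)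
    (hx₁e : x₁ = x₁ * Real.exp (r - y₁) + h) (hy₁e : y₁ = y₁ * Real.exp (r - x₁) + h)
    (hx₂e : x₂ = x₂ * Real.exp (r - y₂) + h) (hy₂e : y₂ = y₂ * Real.exp (r - x₂) + h) :
    False := by
  have key : ∀ {p q s t : ℝ}, p = p * Real.exp (r - s) + h → q = q * Real.exp (r - t) + h →
      h * (p - q) = p * q * (2 * Real.exp (r - (s + t) / 2) * Real.sinh ((t - s) / 2)) := by
    intro p q s t hp hq
    rw [← exp_sub_exp_eq_sinh]
    linear_combination q * hp - p * hq
  have k1 := key hx₁e hx₂e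
  have k2 := key hy₂e hy₁e
  have k3 := key hy₁e hx₁e
  have k4 := key hy₂e hx₂e
  have hlt := mul_sinh_mul_sinh_lt (a := (x₁ - x₂) / 2) (b := (y₂ - y₁) / 2)
    (m := (y₁ - x₁) / 2) (by linarith) (by linarith) (by linarith)
  have e1 : (x₁ - x₂) / 2 + (y₂ - y₁) / 2 + (y₁ - x₁) / 2 = (y₂ - x₂) / 2 := by ring
  rw [e1] at hlt
  have hE : Real.exp (r - (y₁ + y₂) / 2) * Real.exp (r - (x₂ + x₁) / 2) =
      Real.exp (r - (x₁ + y₁) / 2) * Real.exp (r - (x₂ + y₂) / 2) := by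
    rw [← Real.exp_add, ← Real.exp_add]
    ring_nf
  have hx₁ : 0 < x₁ := hx₂.trans hx
  have hy₁ : 0 < y₁ := hx₁.trans hxy
  have hy₂ : 0 < y₂ := hy₁.trans hy
  set C := h ^ 2 * (x₁ * x₂ * y₁ * y₂) *
    (Real.exp (r - (x₁ + y₁) / 2) * Real.exp (r - (x₂ + y₂) / 2)) with hC
  have hCpos : 0 < C := by positivity
  have hprod : C * ((x₁ - x₂) * (y₂ - y₁) *
        (Real.sinh ((y₁ - x₁) / 2) * Real.sinh ((y₂ - x₂) / 2))) =
      C * ((y₁ - x₁) * (y₂ - x₂) *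
        (Real.sinh ((y₂ - y₁) / 2) * Real.sinh ((x₁ - x₂) / 2))) := by
    have hl : (h * (x₁ - x₂)) * (h * (y₂ - y₁)) *
        ((y₁ * x₁ * (2 * Real.exp (r - (x₁ + y₁) / 2) * Real.sinh ((y₁ - x₁) / 2))) *
         (y₂ * x₂ * (2 * Real.exp (r - (x₂ + y₂) / 2) * Real.sinh ((y₂ - x₂) / 2)))) =
        (x₁ * x₂ * (2 * Real.exp (r - (y₁ + y₂) / 2) * Real.sinh ((y₂ - y₁) / 2))) *
        (y₂ * y₁ * (2 * Real.exp (r - (x₂ + x₁) / 2) * Real.sinh ((x₁ - x₂) / 2))) *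
        ((h * (y₁ - x₁)) * (h * (y₂ - x₂))) := by
      rw [k1, k2, k3, k4]
    rw [hC]
    linear_combination hl / 4 + h ^ 2 * (x₁ * x₂ * y₁ * y₂) * ((y₁ - x₁) * (y₂ - x₂) *
        (Real.sinh ((y₂ - y₁) / 2) * Real.sinh ((x₁ - x₂) / 2))) * hE
  have := mul_left_cancel₀ hCpos.ne' hprod
  linarith

/-- Beyond the larger pseudo fixed point, the second iterate of `pseudoPartner` lies below the
diagonal. -/
theorem le_of_le_pseudoPartner_pseudoPartner {r h xs ys s : ℝ} (hh : 0 < h) (hrh : r < h)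
    (hrx : r < xs) (hxy : xs < ys)
    (hx : xs = xs * Real.exp (r - ys) + h) (hy : ys = ys * Real.exp (r - xs) + h)
    (hs : s ≤ pseudoPartner r h (pseudoPartner r h s)) : s ≤ ys := by
  by_contra! hlt
  have hry : r < ys := hrx.trans hxy
  have hrs : r < s := hry.trans hlt
  set b := max s (pseudoPartner r h h)
  have hsb : s ≤ b := le_max_left _ _
  have hsub : Set.Icc s b ⊆ Set.Ioi r := fun t ht => hrs.trans_le ht.1
  have hcont : ContinuousOn (fun t => pseudoPartner r h (pseudoPartner r h t) - t)
      (Set.Icc s b) := by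
    refine ContinuousOn.sub ((continuousOn_pseudoPartner r h).comp
      ((continuousOn_pseudoPartner r h).mono hsub) fun t ht => ?_) continuousOn_id
    exact hrh.trans (lt_pseudoPartner hh (hsub ht))
  have hb : pseudoPartner r h (pseudoPartner r h b) - b ≤ 0 := by
    have h1 := pseudoPartner_le_pseudoPartner hh hrh
      (lt_pseudoPartner hh (hrs.trans_le hsb)).le
    have h2 : pseudoPartner r h h ≤ b := le_max_right _ _
    linarith
  obtain ⟨t, ht, hroot⟩ := intermediate_value_Icc' hsb hcont ⟨hb, sub_nonneg.2 hs⟩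
  have hrt : r < t := hsub ht
  have hyt : ys < t := hlt.trans_le ht.1
  have hht := lt_pseudoPartner hh hrt
  have hfix : t = pseudoPartner r h (pseudoPartner r h t) := by
    have : pseudoPartner r h (pseudoPartner r h t) - t = 0 := hroot
    linarith
  refine not_nested_pseudo_fixed_points hh (hh.trans hht) ?_ hxy hyt hx hy
    ((eq_pseudoPartner_iff hrt).1 rfl) ((eq_pseudoPartner_iff (hrh.trans hht)).1 hfix)
  rw [(eq_pseudoPartner_iff hry).2 hx]
  exact pseudoPartner_lt_pseudoPartner hh hry hyt

section Orbit

variable {r h : ℝ} {y : ℕ → ℝ}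

theorem orbit_nonneg (hh : 0 < h) (hy0 : 0 ≤ y 0) (hy1 : 0 ≤ y 1)
    (hrec : ∀ n : ℕ, y (n + 2) = y (n + 1) * Real.exp (r - y n) + h) (n : ℕ) : 0 ≤ y n := by
  induction n using Nat.strong_induction_on with
  | _ n ih =>
    match n, ih with
    | 0, _ => exact hy0
    | 1, _ => exact hy1
    | n + 2, ih =>
      have := ih (n + 1) (by omega)
      rw [hrec]
      positivity

theorem orbit_stocking_le (hh : 0 < h) (hy0 : 0 ≤ y 0) (hy1 : 0 ≤ y 1)
    (hrec : ∀ n : ℕ, y (n + 2) = y (n + 1) * Real.exp (r - y n) + h) (n : ℕ) :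
    h ≤ y (n + 2) := by
  have := orbit_nonneg hh hy0 hy1 hrec (n + 1)
  have := mul_nonneg this (Real.exp_pos (r - y n)).le
  rw [hrec]
  linarith

theorem orbit_bounded (hh : 0 < h) (hrh : r < h) (hy0 : 0 ≤ y 0) (hy1 : 0 ≤ y 1)
    (hrec : ∀ n : ℕ, y (n + 2) = y (n + 1) * Real.exp (r - y n) + h) :
    ∃ B, ∀ n, y (n + 2) ≤ B := by
  refine ⟨max (max (y 2) (y 3)) (pseudoPartner r h h), fun n => ?_⟩
  set B := max (max (y 2) (y 3)) (pseudoPartner r h h)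
  have hB : B * Real.exp (r - h) + h ≤ B := (pseudoPartner_le_iff hrh).1 (le_max_right _ _)
  induction n with
  | zero => exact (le_max_left _ _).trans (le_max_left _ _)
  | succ n ih =>
    rcases n with _ | n
    · exact (le_max_right _ _).trans (le_max_left _ _)
    · have h1 := orbit_stocking_le hh hy0 hy1 hrec n
      have h2 := orbit_nonneg hh hy0 hy1 hrec (n + 3)
      calc y (n + 2 + 2) = y (n + 2 + 1) * Real.exp (r - y (n + 2)) + h := hrec (n + 2)
        _ ≤ B * Real.exp (r - h) + h := by
          gcongr
          exact h2.trans ih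
        _ ≤ B := hB

end Orbit

/-- If `r2 < r < h` and `(x*, y*)` is the pair of pseudo fixed points, then the box
`[x*, y*]²` is an absorbing region: every orbit with nonnegative initial conditions is
eventually squeezed between `x*` and `y*`. -/
theorem ricker_stocking_absorbing_region (r h Hstar r2 xs ys : ℝ)
    (hh : 0 < h) (hr : 0 < r)
    (hH : Hstar = (h + Real.sqrt (h ^ 2 + 4 * h)) / 2)
    (hr2 : r2 = Hstar + Real.log (Hstar - h) - Real.log Hstar)
    (hr2r : r2 < r) (hrh : r < h)
    (hxs : 0 < xs) (hxsys : xs < ys)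
    (heqx : xs = xs * Real.exp (r - ys) + h)
    (heqy : ys = ys * Real.exp (r - xs) + h)
    (y : ℕ → ℝ) (hy0 : 0 ≤ y 0) (hy1 : 0 ≤ y 1)
    (hrec : ∀ n : ℕ, y (n + 2) = y (n + 1) * Real.exp (r - y n) + h) :
    xs ≤ Filter.liminf y Filter.atTop ∧
    Filter.liminf y Filter.atTop ≤ Filter.limsup y Filter.atTop ∧
    Filter.limsup y Filter.atTop ≤ ys := by
  have hpos := orbit_nonneg hh hy0 hy1 hrec
  have hlow := orbit_stocking_le hh hy0 hy1 hrec
  obtain ⟨B, hB⟩ := orbit_bounded hh hrh hy0 hy1 hrec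
  have hlow' : ∀ᶠ n in atTop, h ≤ y n := by
    rw [← map_add_atTop_eq_nat 2, eventually_map]
    exact Eventually.of_forall hlow
  have hup' : ∀ᶠ n in atTop, y n ≤ B := by
    rw [← map_add_atTop_eq_nat 2, eventually_map]
    exact Eventually.of_forall hB
  have hbU : IsBoundedUnder (· ≤ ·) atTop y := ⟨B, hup'⟩
  have hbL : IsBoundedUnder (· ≥ ·) atTop y := ⟨h, hlow'⟩
  have hcU : IsCoboundedUnder (· ≤ ·) atTop y := hbL.isCoboundedUnder_le
  have hcL : IsCoboundedUnder (· ≥ ·) atTop y := hbU.isCoboundedUnder_ge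
  have hIS : liminf y atTop ≤ limsup y atTop := liminf_le_limsup hbU hbL
  have hI : h ≤ liminf y atTop := le_liminf_of_le hcL hlow'
  set I := liminf y atTop
  set S := limsup y atTop
  have hevL : ∀ ε > 0, ∀ᶠ n in atTop, I - ε < y n := fun ε hε =>
    eventually_lt_of_lt_liminf (sub_lt_self I hε) hbL
  have hevU : ∀ ε > 0, ∀ᶠ n in atTop, y n < S + ε := fun ε hε =>
    eventually_lt_of_limsup_lt (lt_add_of_pos_right S hε) hbU
  have hS_le : S ≤ S * Real.exp (r - I) + h := by
    have hlim : Tendsto (fun ε : ℝ => (S + ε) * Real.exp (r - (I - ε)) + h) (𝓝[>] 0)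
        (𝓝 (S * Real.exp (r - I) + h)) := by
      have hc : Continuous fun ε : ℝ => (S + ε) * Real.exp (r - (I - ε)) + h := by fun_prop
      simpa using (hc.tendsto 0).mono_left nhdsWithin_le_nhds
    refine ge_of_tendsto hlim ?_
    filter_upwards [self_mem_nhdsWithin] with ε hε
    refine limsup_le_of_le hcU ?_
    rw [← map_add_atTop_eq_nat 2, eventually_map]
    filter_upwards [hevL ε hε, (tendsto_add_atTop_nat 1).eventually (hevU ε hε)] with n h1 h2
    rw [hrec]
    have := hpos (n + 1)
    gcongr
    linarith
  have hI_ge : I * Real.exp (r - S) + h ≤ I := by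
    have hlim : Tendsto (fun ε : ℝ => (I - ε) * Real.exp (r - (S + ε)) + h) (𝓝[>] 0)
        (𝓝 (I * Real.exp (r - S) + h)) := by
      have hc : Continuous fun ε : ℝ => (I - ε) * Real.exp (r - (S + ε)) + h := by fun_prop
      simpa using (hc.tendsto 0).mono_left nhdsWithin_le_nhds
    refine le_of_tendsto hlim ?_
    filter_upwards [self_mem_nhdsWithin] with ε hε
    refine le_liminf_of_le hcL ?_
    rw [← map_add_atTop_eq_nat 2, eventually_map]
    filter_upwards [hevU ε hε, (tendsto_add_atTop_nat 1).eventually (hevL ε hε)] with n h1 h2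
    rw [hrec]
    have := hpos (n + 1)
    gcongr
  have hrI : r < I := hrh.trans_le hI
  have hrS : r < S := hrI.trans_le hIS
  have hrx : r < xs := by
    have := mul_pos hxs (Real.exp_pos (r - ys))
    linarith
  have hI_partner : pseudoPartner r h S ≤ I := (pseudoPartner_le_iff hrS).2 hI_ge
  have hSy : S ≤ ys := by
    refine le_of_le_pseudoPartner_pseudoPartner hh hrh hrx hxsys heqx heqy ?_
    exact ((le_pseudoPartner_iff hrI).2 hS_le).trans
      (pseudoPartner_le_pseudoPartner hh (hrh.trans (lt_pseudoPartner hh hrS)) hI_partner)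
  refine ⟨?_, hIS, hSy⟩
  rw [(eq_pseudoPartner_iff (hrx.trans hxsys)).2 heqx]
  exact (pseudoPartner_le_pseudoPartner hh hrS hSy).trans hI_partner
end

section
/- Let a ≤ b be reals and let F : ℝ × ℝ → ℝ be continuous on [a, b] × [a, b], nondecreasing in its first argument and nonincreasing in its second argument on [a, b] × [a, b], and suppose a ≤ F(a, b) and F(b, a) ≤ b. Let (x_n) satisfy x_{n+2} = F(x_{n+1}, x_n) for all n ≥ 0, and suppose that for some index k both x_k and x_{k+1} lie in [a, b]. (i) If the only pair (x, y) ∈ [a, b] × [a, b] with x = F(x, y) and y = F(y, x) is a pair with x = y = x̄, then x_n converges to x̄. (ii) If the set of such pairs is exactly {(x*, y*), (c, c), (y*, x*)} with x* < y*, then x* ≤ liminf x_n ≤ limsup x_n ≤ y*. -/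
open Filter Set Topology

/-- A mixed monotone function on a box sends every subsquare `[l, h]²` into
`[F (l, h), F (h, l)]`. -/
lemma mixedMonotone_mem_Icc {a b : ℝ} {F : ℝ × ℝ → ℝ}
    (hmono : ∀ x₁ x₂ y : ℝ, x₁ ∈ Icc a b → x₂ ∈ Icc a b → y ∈ Icc a b →
      x₁ ≤ x₂ → F (x₁, y) ≤ F (x₂, y))
    (hanti : ∀ x y₁ y₂ : ℝ, x ∈ Icc a b → y₁ ∈ Icc a b → y₂ ∈ Icc a b →
      y₁ ≤ y₂ → F (x, y₂) ≤ F (x, y₁))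
    {l h y z : ℝ} (hl : l ∈ Icc a b) (hh : h ∈ Icc a b) (hy : y ∈ Icc l h) (hz : z ∈ Icc l h) :
    F (y, z) ∈ Icc (F (l, h)) (F (h, l)) := by
  have hy' : y ∈ Icc a b := Icc_subset_Icc hl.1 hh.2 hy
  have hz' : z ∈ Icc a b := Icc_subset_Icc hl.1 hh.2 hz
  exact ⟨(hanti l z h hl hz' hh hz.2).trans (hmono l y z hl hy' hz' hy.1),
    (hmono y h z hy' hh hz' hy.2).trans (hanti h l z hh hl hz' hz.1)⟩

/-- The monotone iteration of the symmetric embedding `(x, y) ↦ (F (x, y), F (y, x))` from the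
southeast-extremal corner `(a, b)`: it converges to a solution `(m, M)` which encloses all other
solutions, and `[m, M]` attracts every orbit of the delayed equation that enters the box. -/
lemma exists_extremal_pseudoFixedPoint {a b : ℝ} (hab : a ≤ b) {F : ℝ × ℝ → ℝ}
    (hcont : ContinuousOn F (Icc a b ×ˢ Icc a b))
    (hmono : ∀ x₁ x₂ y : ℝ, x₁ ∈ Icc a b → x₂ ∈ Icc a b → y ∈ Icc a b →
      x₁ ≤ x₂ → F (x₁, y) ≤ F (x₂, y))
    (hanti : ∀ x y₁ y₂ : ℝ, x ∈ Icc a b → y₁ ∈ Icc a b → y₂ ∈ Icc a b →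
      y₁ ≤ y₂ → F (x, y₂) ≤ F (x, y₁))
    (hFa : a ≤ F (a, b)) (hFb : F (b, a) ≤ b)
    {x : ℕ → ℝ} (hrec : ∀ n : ℕ, x (n + 2) = F (x (n + 1), x n))
    {k : ℕ} (hk1 : x k ∈ Icc a b) (hk2 : x (k + 1) ∈ Icc a b) :
    ∃ m M : ℝ, (m ∈ Icc a b ∧ M ∈ Icc a b ∧ m = F (m, M) ∧ M = F (M, m)) ∧ m ≤ M ∧
      (∀ p ∈ Icc a b, ∀ q ∈ Icc a b, p = F (p, q) → q = F (q, p) →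
        p ∈ Icc m M ∧ q ∈ Icc m M) ∧
      (∀ l < m, ∀ᶠ n in atTop, l < x n) ∧ (∀ h > M, ∀ᶠ n in atTop, x n < h) := by
  have trap {l h y z : ℝ} := @mixedMonotone_mem_Icc a b F hmono hanti l h y z
  obtain ⟨A, B, hA0, hB0, hA, hB⟩ : ∃ A B : ℕ → ℝ, A 0 = a ∧ B 0 = b ∧
      (∀ j, A (j + 1) = F (A j, B j)) ∧ ∀ j, B (j + 1) = F (B j, A j) := by
    let G : ℝ × ℝ → ℝ × ℝ := fun p ↦ (F (p.1, p.2), F (p.2, p.1))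
    refine ⟨fun j ↦ (G^[j] (a, b)).1, fun j ↦ (G^[j] (a, b)).2, rfl, rfl, fun j ↦ ?_, fun j ↦ ?_⟩
      <;> simp only [Function.iterate_succ_apply', G]
  have hbox : ∀ j, A j ∈ Icc a b ∧ B j ∈ Icc a b ∧ A j ≤ B j ∧
      A j ≤ A (j + 1) ∧ B (j + 1) ≤ B j := by
    intro j
    induction j with
    | zero =>
      rw [hA, hB, hA0, hB0]
      exact ⟨left_mem_Icc.2 hab, right_mem_Icc.2 hab, hab, hFa, hFb⟩
    | succ j ih =>
      obtain ⟨hAj, hBj, hle, hAs, hBs⟩ := ih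
      have hle' : A (j + 1) ≤ B (j + 1) := by
        have := trap hAj hBj (left_mem_Icc.2 hle) (right_mem_Icc.2 hle)
        rw [hA, hB]
        exact this.2
      have hA' : A (j + 1) ∈ Icc (A j) (B j) := ⟨hAs, hle'.trans hBs⟩
      have hB' : B (j + 1) ∈ Icc (A j) (B j) := ⟨hAs.trans hle', hBs⟩
      refine ⟨Icc_subset_Icc hAj.1 hBj.2 hA', Icc_subset_Icc hAj.1 hBj.2 hB', hle', ?_, ?_⟩
      · rw [hA (j + 1)]
        exact (hA j).trans_le (trap hAj hBj hA' hB').1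
      · rw [hB (j + 1)]
        exact (trap hAj hBj hB' hA').2.trans_eq (hB j).symm
  have hAmono : Monotone A := monotone_nat_of_le_succ fun j ↦ (hbox j).2.2.2.1
  have hBanti : Antitone B := antitone_nat_of_succ_le fun j ↦ (hbox j).2.2.2.2
  obtain ⟨m, hAm⟩ : ∃ m, Tendsto A atTop (𝓝 m) :=
    ⟨_, tendsto_atTop_ciSup hAmono ⟨b, forall_mem_range.2 fun j ↦ (hbox j).1.2⟩⟩
  obtain ⟨M, hBM⟩ : ∃ M, Tendsto B atTop (𝓝 M) :=
    ⟨_, tendsto_atTop_ciInf hBanti ⟨a, forall_mem_range.2 fun j ↦ (hbox j).2.1.1⟩⟩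
  have hm : m ∈ Icc a b := isClosed_Icc.mem_of_tendsto hAm (.of_forall fun j ↦ (hbox j).1)
  have hM : M ∈ Icc a b := isClosed_Icc.mem_of_tendsto hBM (.of_forall fun j ↦ (hbox j).2.1)
  have hlim {u v : ℕ → ℝ} {p q : ℝ} (hu : Tendsto u atTop (𝓝 p)) (hv : Tendsto v atTop (𝓝 q))
      (hp : p ∈ Icc a b) (hq : q ∈ Icc a b) (huI : ∀ j, u j ∈ Icc a b) (hvI : ∀ j, v j ∈ Icc a b)
      (huv : ∀ j, u (j + 1) = F (u j, v j)) : p = F (p, q) := by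
    have hF : Tendsto (fun j ↦ F (u j, v j)) atTop (𝓝 (F (p, q))) :=
      (hcont (p, q) ⟨hp, hq⟩).tendsto.comp
        (tendsto_nhdsWithin_iff.2 ⟨hu.prodMk_nhds hv, .of_forall fun j ↦ ⟨huI j, hvI j⟩⟩)
    simp only [← huv] at hF
    exact tendsto_nhds_unique ((tendsto_add_atTop_iff_nat 1).2 hu) hF
  have horbit : ∀ j n, k + 2 * j ≤ n → x n ∈ Icc (A j) (B j) := by
    intro j
    induction j with
    | zero =>
      rw [hA0, hB0]
      have : ∀ i, x (k + i) ∈ Icc a b ∧ x (k + i + 1) ∈ Icc a b := by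
        intro i
        induction i with
        | zero => exact ⟨hk1, hk2⟩
        | succ i ih =>
          refine ⟨ih.2, ?_⟩
          rw [← add_assoc, hrec]
          exact Icc_subset_Icc hFa hFb
            (trap (left_mem_Icc.2 hab) (right_mem_Icc.2 hab) ih.2 ih.1)
      intro n hn
      obtain ⟨i, rfl⟩ := Nat.exists_eq_add_of_le hn
      exact (this i).1
    | succ j ih =>
      intro n hn
      obtain ⟨i, rfl⟩ := Nat.exists_eq_add_of_le (show 2 ≤ n by lia)
      rw [add_comm 2 i, hrec, hA, hB]
      exact trap (hbox j).1 (hbox j).2.1 (ih _ (by lia)) (ih _ (by lia))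
  have hencl {p q : ℝ} (hp : p ∈ Icc a b) (hq : q ∈ Icc a b) (hpq : p = F (p, q))
      (hqp : q = F (q, p)) : ∀ j, p ∈ Icc (A j) (B j) ∧ q ∈ Icc (A j) (B j) := by
    intro j
    induction j with
    | zero => rw [hA0, hB0]; exact ⟨hp, hq⟩
    | succ j ih =>
      have h₁ := trap (hbox j).1 (hbox j).2.1 ih.1 ih.2
      have h₂ := trap (hbox j).1 (hbox j).2.1 ih.2 ih.1
      rw [← hpq, ← hA, ← hB] at h₁
      rw [← hqp, ← hA, ← hB] at h₂
      exact ⟨h₁, h₂⟩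
  refine ⟨m, M, ⟨hm, hM,
    hlim hAm hBM hm hM (fun j ↦ (hbox j).1) (fun j ↦ (hbox j).2.1) hA,
    hlim hBM hAm hM hm (fun j ↦ (hbox j).2.1) (fun j ↦ (hbox j).1) hB⟩,
    le_of_tendsto_of_tendsto' hAm hBM fun j ↦ (hbox j).2.2.1, ?_, ?_, ?_⟩
  · intro p hp q hq hpq hqp
    have h := hencl hp hq hpq hqp
    exact ⟨⟨le_of_tendsto' hAm fun j ↦ (h j).1.1, ge_of_tendsto' hBM fun j ↦ (h j).1.2⟩,
      ⟨le_of_tendsto' hAm fun j ↦ (h j).2.1, ge_of_tendsto' hBM fun j ↦ (h j).2.2⟩⟩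
  · intro l hl
    obtain ⟨j, hj⟩ := (hAm.eventually_const_lt hl).exists
    filter_upwards [eventually_ge_atTop (k + 2 * j)] with n hn
    exact hj.trans_le (horbit j n hn).1
  · intro h hh
    obtain ⟨j, hj⟩ := (hBM.eventually_lt_const hh).exists
    filter_upwards [eventually_ge_atTop (k + 2 * j)] with n hn
    exact (horbit j n hn).2.trans_lt hj

/-- Embedding/convergence result for the delayed difference equation
`x_{n+2} = F(x_{n+1}, x_n)` in a box `[a, b]²` with `F` nondecreasing in its first
argument and nonincreasing in its second one:
(i) if the only solution of `x = F(x, y)`, `y = F(y, x)` in the box is the diagonal pair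
`(x̄, x̄)`, the orbit converges to `x̄`;
(ii) if the solutions are exactly `{(x*, y*), (c, c), (y*, x*)}` with `x* < y*`, then
`x* ≤ liminf x_n ≤ limsup x_n ≤ y*`. -/
theorem embedding_global_attractor (a b : ℝ) (hab : a ≤ b) (F : ℝ × ℝ → ℝ)
    (hcont : ContinuousOn F (Set.Icc a b ×ˢ Set.Icc a b))
    (hmono : ∀ x₁ x₂ y : ℝ, x₁ ∈ Set.Icc a b → x₂ ∈ Set.Icc a b → y ∈ Set.Icc a b →
      x₁ ≤ x₂ → F (x₁, y) ≤ F (x₂, y))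
    (hanti : ∀ x y₁ y₂ : ℝ, x ∈ Set.Icc a b → y₁ ∈ Set.Icc a b → y₂ ∈ Set.Icc a b →
      y₁ ≤ y₂ → F (x, y₂) ≤ F (x, y₁))
    (hFa : a ≤ F (a, b)) (hFb : F (b, a) ≤ b)
    (x : ℕ → ℝ) (hrec : ∀ n : ℕ, x (n + 2) = F (x (n + 1), x n))
    (k : ℕ) (hk1 : x k ∈ Set.Icc a b) (hk2 : x (k + 1) ∈ Set.Icc a b) :
    (∀ xbar : ℝ,
      {p : ℝ × ℝ | p ∈ Set.Icc a b ×ˢ Set.Icc a b ∧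
          p.1 = F (p.1, p.2) ∧ p.2 = F (p.2, p.1)} = {(xbar, xbar)} →
      Filter.Tendsto x Filter.atTop (nhds xbar)) ∧
    (∀ xs ys c : ℝ, xs < ys →
      {p : ℝ × ℝ | p ∈ Set.Icc a b ×ˢ Set.Icc a b ∧
          p.1 = F (p.1, p.2) ∧ p.2 = F (p.2, p.1)} = {(xs, ys), (c, c), (ys, xs)} →
      xs ≤ Filter.liminf x Filter.atTop ∧
      Filter.liminf x Filter.atTop ≤ Filter.limsup x Filter.atTop ∧
      Filter.limsup x Filter.atTop ≤ ys) := by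
  obtain ⟨m, M, ⟨hm, hM, hmF, hMF⟩, hmM, hencl, hlow, hup⟩ :=
    exists_extremal_pseudoFixedPoint hab hcont hmono hanti hFa hFb hrec hk1 hk2
  refine ⟨fun xbar hset ↦ ?_, fun xs ys c hlt hset ↦ ?_⟩
  · have hmem : (m, M) ∈ ({(xbar, xbar)} : Set (ℝ × ℝ)) := hset ▸ ⟨⟨hm, hM⟩, hmF, hMF⟩
    obtain ⟨rfl, rfl⟩ := Prod.mk.inj hmem
    exact tendsto_order.2 ⟨hlow, hup⟩
  · have hmem : (m, M) ∈ ({(xs, ys), (c, c), (ys, xs)} : Set (ℝ × ℝ)) :=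
      hset ▸ ⟨⟨hm, hM⟩, hmF, hMF⟩
    have hsol : (xs, ys) ∈ {p : ℝ × ℝ | p ∈ Set.Icc a b ×ˢ Set.Icc a b ∧
        p.1 = F (p.1, p.2) ∧ p.2 = F (p.2, p.1)} := hset ▸ mem_insert _ _
    obtain ⟨⟨hxs, hys⟩, hxsF, hysF⟩ := hsol
    obtain ⟨hxsI, hysI⟩ := hencl xs hxs ys hys hxsF hysF
    obtain ⟨rfl, rfl⟩ : m = xs ∧ M = ys := by
      simp only [mem_insert_iff, mem_singleton_iff, Prod.mk.injEq] at hmem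
      rcases hmem with h | ⟨rfl, rfl⟩ | ⟨rfl, rfl⟩
      · exact h
      · linarith [hxsI.1, hysI.2]
      · linarith
    have hbelow : IsBoundedUnder (· ≥ ·) atTop x :=
      isBoundedUnder_of_eventually_ge ((hlow (m - 1) (by linarith)).mono fun _ h ↦ h.le)
    have habove : IsBoundedUnder (· ≤ ·) atTop x :=
      isBoundedUnder_of_eventually_le ((hup (M + 1) (by linarith)).mono fun _ h ↦ h.le)
    refine ⟨?_, liminf_le_limsup habove hbelow, ?_⟩
    · exact le_of_forall_lt fun l hl ↦ by
        obtain ⟨l', hl', hl'm⟩ := exists_between hl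
        exact hl'.trans_le (le_liminf_of_le habove.isCoboundedUnder_ge
          ((hlow l' hl'm).mono fun _ h ↦ h.le))
    · exact le_of_forall_gt fun h hh ↦ by
        obtain ⟨h', hMh', hh'⟩ := exists_between hh
        exact (limsup_le_of_le hbelow.isCoboundedUnder_le
          ((hup h' hMh').mono fun _ h ↦ h.le)).trans_lt hh'
end

section
/- For every r > 0 and all h₀, h₁ ≥ 0 there exist z₀, z₁ > 0 satisfying z₀ = z₁·exp(r − z₀) + h₁ and z₁ = z₀·exp(r − z₁) + h₀; that is, the Ricker model with delay and 2-periodic stocking has a 2-periodic solution. -/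
/-- The Ricker model with delay and 2-periodic stocking has a 2-periodic solution: for
every `r > 0` and `h₀, h₁ ≥ 0` there exist `z₀, z₁ > 0` with `z₀ = z₁·exp(r − z₀) + h₁`
and `z₁ = z₀·exp(r − z₁) + h₀`. -/
theorem ricker_periodic_stocking_two_cycle_exists (r h₀ h₁ : ℝ)
    (hr : 0 < r) (hh₀ : 0 ≤ h₀) (hh₁ : 0 ≤ h₁) :
    ∃ z₀ z₁ : ℝ, 0 < z₀ ∧ 0 < z₁ ∧
      z₀ = z₁ * Real.exp (r - z₀) + h₁ ∧ z₁ = z₀ * Real.exp (r - z₁) + h₀ := by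
  -- The first equation gives `z₁ = f z₀`; the second is then solved by the
  -- intermediate value theorem.
  let f : ℝ → ℝ := fun x => (x - h₁) * Real.exp (x - r)
  let g : ℝ → ℝ := fun x => f x - x * Real.exp (r - f x) - h₀
  have hg : Continuous g := by fun_prop
  obtain ⟨a, ha, haM, hga⟩ :
      ∃ a, 0 < a ∧ a ≤ r + h₀ + h₁ + 1 ∧ g a ≤ 0 := by
    rcases hh₁.eq_or_lt with h | h
    · refine ⟨r, hr, by linarith, ?_⟩
      simp [g, f, ← h, hh₀]
    · refine ⟨h₁, h, by linarith, ?_⟩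
      have := mul_pos h (Real.exp_pos r)
      simp only [g, f, sub_self, zero_mul, sub_zero]
      linarith
  have hgM : 0 ≤ g (r + h₀ + h₁ + 1) := by
    have hf : (r + h₀ + 1) * (h₀ + h₁ + 2) ≤ f (r + h₀ + h₁ + 1) := by
      have he := Real.add_one_le_exp (r + h₀ + h₁ + 1 - r)
      have : r + h₀ + h₁ + 1 - h₁ = r + h₀ + 1 := by ring
      simp only [f, this]
      exact mul_le_mul_of_nonneg_left (by linarith) (by positivity)
    have hexp : Real.exp (r - f (r + h₀ + h₁ + 1)) ≤ 1 :=
      Real.exp_le_one_iff.2 (by nlinarith)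
    have := mul_le_of_le_one_right (by positivity : 0 ≤ r + h₀ + h₁ + 1) hexp
    simp only [g]
    nlinarith [mul_nonneg hr.le hh₀, mul_nonneg hr.le hh₁, mul_nonneg hh₀ hh₁]
  obtain ⟨x, hx, hgx⟩ := intermediate_value_Icc haM hg.continuousOn ⟨hga, hgM⟩
  have hx0 : 0 < x := ha.trans_le hx.1
  have hfx : f x = x * Real.exp (r - f x) + h₀ := by
    simp only [g] at hgx
    linarith
  refine ⟨x, f x, hx0, ?_, ?_, hfx⟩
  · rw [hfx]
    positivity
  · simp only [f]
    rw [mul_assoc, ← Real.exp_add]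
    simp
end

section
/- Let r > 0 and h₀, h₁ ≥ 0, and let z₀, z₁ > 0 satisfy z₀ = z₁·exp(r − z₀) + h₁ and z₁ = z₀·exp(r − z₁) + h₀. Then h₀ > h₁ if and only if z₁ > z₀. -/
/-- If `a < b`, then `a * exp (r - b) < b * exp (r - a)` for positive `b`. -/
lemma mul_exp_sub_lt_mul_exp_sub {r a b : ℝ} (hb : 0 < b) (hab : a < b) :
    a * Real.exp (r - b) < b * Real.exp (r - a) :=
  calc a * Real.exp (r - b) < b * Real.exp (r - b) := by gcongr
    _ < b * Real.exp (r - a) := by gcongr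

/-- For a 2-cycle `(z₀, z₁)` of the Ricker model with delay and 2-periodic stocking,
`h₀ > h₁` if and only if `z₁ > z₀`. -/
theorem ricker_periodic_stocking_h0_gt_h1_iff (r h₀ h₁ z₀ z₁ : ℝ)
    (hr : 0 < r) (hh₀ : 0 ≤ h₀) (hh₁ : 0 ≤ h₁)
    (hz₀ : 0 < z₀) (hz₁ : 0 < z₁)
    (heq₀ : z₀ = z₁ * Real.exp (r - z₀) + h₁)
    (heq₁ : z₁ = z₀ * Real.exp (r - z₁) + h₀) :
    h₀ > h₁ ↔ z₁ > z₀ := by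
  constructor
  · intro h
    by_contra! hle
    rcases hle.eq_or_lt with rfl | hlt
    · linarith
    · linarith [mul_exp_sub_lt_mul_exp_sub (r := r) hz₀ hlt]
  · intro h
    linarith [mul_exp_sub_lt_mul_exp_sub (r := r) hz₁ h]
end

section
/- Let r > 0 and h₀, h₁ > r with h₀ ≠ h₁, write f(t) = exp(r − t), and let z₀, z₁ > 0 satisfy z₀ = z₁·f(z₀) + h₁ and z₁ = z₀·f(z₁) + h₀. Assume that the only pair (x, y) with x, y > 0 satisfying x − h₁ = (x·f(y) + h₀)·f(y·f(x) + h₁) and y − h₀ = (y·f(x) + h₁)·f(x·f(y) + h₀) is (x, y) = (z₀, z₁). Then the 2-cycle {z₀, z₁} is globally asymptotically stable: for every sequence (y_n) with y_0, y_1 ≥ 0 and y_{n+2} = y_{n+1}·exp(r − y_n) + h_{n mod 2} for all n ≥ 0, the even-indexed terms y_{2n} converge to z₁ and the odd-indexed terms y_{2n+1} converge to z₀. -/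
open Filter Topology

/-- The Ricker term `p * exp (r - t) + h` increases in `p ≥ 0` and decreases in `t`. -/
theorem ricker_term_le {r p q s t : ℝ} (h : ℝ) (hp : 0 ≤ p) (hpq : p ≤ q) (hst : s ≤ t) :
    p * Real.exp (r - t) + h ≤ q * Real.exp (r - s) + h := by
  have hq : 0 ≤ q := hp.trans hpq
  gcongr

/-- If `r < h`, the Ricker map with density factor frozen at `h` maps `[0, M]` into itself for all
large `M`. -/
theorem ricker_term_le_self {r h M : ℝ} (hM : h / (1 - Real.exp (r - h)) ≤ M) (hh : r < h) :
    M * Real.exp (r - h) + h ≤ M := by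
  have h1 : Real.exp (r - h) < 1 := Real.exp_lt_one_iff.2 (by linarith)
  rw [div_le_iff₀ (by linarith)] at hM
  linarith

/-- The mixed-monotone embedding of the 2-periodic Ricker model: it acts on tuples `(a, A, b, B)`
recording bounds `[a, A]` for even-indexed and `[b, B]` for odd-indexed terms. -/
noncomputable def rickerEmbedding (r h₀ h₁ : ℝ) (u : ℝ × ℝ × ℝ × ℝ) : ℝ × ℝ × ℝ × ℝ :=
  (u.2.2.1 * Real.exp (r - u.2.1) + h₀, u.2.2.2 * Real.exp (r - u.1) + h₀,
    u.1 * Real.exp (r - u.2.2.2) + h₁, u.2.1 * Real.exp (r - u.2.2.1) + h₁)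

/-- Iterating the embedding from a box which it maps into itself produces nested boxes that
converge to a fixed point and trap the trajectory. -/
theorem exists_tendsto_ricker_bounds {r h₀ h₁ M : ℝ} (hh₀ : 0 < h₀) (hh₁ : 0 < h₁)
    (hM₀ : M * Real.exp (r - h₀) + h₀ ≤ M) (hM₁ : M * Real.exp (r - h₁) + h₁ ≤ M)
    (e o : ℕ → ℝ) (he : h₀ ≤ e 0 ∧ e 0 ≤ M) (ho : h₁ ≤ o 0 ∧ o 0 ≤ M)
    (hes : ∀ n, e (n + 1) = o n * Real.exp (r - e n) + h₀)
    (hos : ∀ n, o (n + 1) = e (n + 1) * Real.exp (r - o n) + h₁) :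
    ∃ (u : ℕ → ℝ × ℝ × ℝ × ℝ) (l : ℝ × ℝ × ℝ × ℝ),
      Tendsto u atTop (𝓝 l) ∧ rickerEmbedding r h₀ h₁ l = l ∧ h₀ ≤ l.1 ∧ h₁ ≤ l.2.2.2 ∧
      ∀ n, ((u n).1 ≤ e n ∧ e n ≤ (u n).2.1) ∧ ((u n).2.2.1 ≤ o n ∧ o n ≤ (u n).2.2.2) := by
  set T := rickerEmbedding r h₀ h₁ with hT
  let u : ℕ → ℝ × ℝ × ℝ × ℝ := fun n => T^[n] (h₀, M, h₁, M)
  have hsucc : ∀ n, u (n + 1) = T (u n) := fun n => Function.iterate_succ_apply' T n _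
  have ha : ∀ n, (u (n + 1)).1 = (u n).2.2.1 * Real.exp (r - (u n).2.1) + h₀ :=
    fun n => by rw [hsucc]; rfl
  have hA : ∀ n, (u (n + 1)).2.1 = (u n).2.2.2 * Real.exp (r - (u n).1) + h₀ :=
    fun n => by rw [hsucc]; rfl
  have hb : ∀ n, (u (n + 1)).2.2.1 = (u n).1 * Real.exp (r - (u n).2.2.2) + h₁ :=
    fun n => by rw [hsucc]; rfl
  have hB : ∀ n, (u (n + 1)).2.2.2 = (u n).2.1 * Real.exp (r - (u n).2.2.1) + h₁ :=
    fun n => by rw [hsucc]; rfl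
  have nested : ∀ n, (h₀ ≤ (u n).1 ∧ h₁ ≤ (u n).2.2.1) ∧
      (((u n).1 ≤ e n ∧ e n ≤ (u n).2.1) ∧ ((u n).2.2.1 ≤ o n ∧ o n ≤ (u n).2.2.2)) ∧
      ((u n).1 ≤ (u (n + 1)).1 ∧ (u (n + 1)).2.1 ≤ (u n).2.1) ∧
      ((u n).2.2.1 ≤ (u (n + 1)).2.2.1 ∧ (u (n + 1)).2.2.2 ≤ (u n).2.2.2) := by
    intro n
    induction n with
    | zero =>
      have h0 : u 0 = (h₀, M, h₁, M) := rfl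
      rw [ha, hA, hb, hB, h0]
      have p₀ : 0 ≤ h₁ * Real.exp (r - M) := by positivity
      have p₁ : 0 ≤ h₀ * Real.exp (r - M) := by positivity
      exact ⟨⟨le_rfl, le_rfl⟩, ⟨he, ho⟩, ⟨le_add_of_nonneg_left p₀, hM₀⟩,
        ⟨le_add_of_nonneg_left p₁, hM₁⟩⟩
    | succ n ih =>
      obtain ⟨⟨la, lb⟩, ⟨⟨ea, eA⟩, ⟨ob, oB⟩⟩, ⟨ma, mA⟩, ⟨mb, mB⟩⟩ := ih
      have ea' : (u (n + 1)).1 ≤ e (n + 1) := by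
        rw [ha, hes]; exact ricker_term_le _ (by linarith) ob eA
      have eA' : e (n + 1) ≤ (u (n + 1)).2.1 := by
        rw [hA, hes]; exact ricker_term_le _ (by linarith) oB ea
      have ob' : (u (n + 1)).2.2.1 ≤ o (n + 1) := by
        rw [hb, hos]; exact ricker_term_le _ (by linarith) (ma.trans ea') oB
      have oB' : o (n + 1) ≤ (u (n + 1)).2.2.2 := by
        rw [hB, hos]; exact ricker_term_le _ (by linarith) (eA'.trans mA) ob
      refine ⟨⟨by linarith, by linarith⟩, ⟨⟨ea', eA'⟩, ob', oB'⟩, ⟨?_, ?_⟩, ?_, ?_⟩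
      · exact (ha n).trans_le ((ricker_term_le _ (by linarith) mb mA).trans_eq (ha (n + 1)).symm)
      · exact (hA (n + 1)).trans_le ((ricker_term_le _ (by linarith) mB ma).trans_eq (hA n).symm)
      · exact (hb n).trans_le ((ricker_term_le _ (by linarith) ma mB).trans_eq (hb (n + 1)).symm)
      · exact (hB (n + 1)).trans_le ((ricker_term_le _ (by linarith) mA mb).trans_eq (hB n).symm)
  have ma : Monotone fun n => (u n).1 := monotone_nat_of_le_succ fun n => (nested n).2.2.1.1
  have mA : Antitone fun n => (u n).2.1 := antitone_nat_of_succ_le fun n => (nested n).2.2.1.2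
  have mb : Monotone fun n => (u n).2.2.1 := monotone_nat_of_le_succ fun n => (nested n).2.2.2.1
  have mB : Antitone fun n => (u n).2.2.2 := antitone_nat_of_succ_le fun n => (nested n).2.2.2.2
  have leM : ∀ n, (u n).1 ≤ M ∧ (u n).2.2.1 ≤ M := fun n => by
    have h1 : (u n).2.1 ≤ M := mA (Nat.zero_le n)
    have h2 : (u n).2.2.2 ≤ M := mB (Nat.zero_le n)
    obtain ⟨-, ⟨⟨_, _⟩, _, _⟩, -⟩ := nested n
    constructor <;> linarith
  have geA : ∀ n, h₀ ≤ (u n).2.1 ∧ h₁ ≤ (u n).2.2.2 := fun n => by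
    obtain ⟨⟨_, _⟩, ⟨⟨_, _⟩, _, _⟩, -⟩ := nested n
    constructor <;> linarith
  have ta := tendsto_atTop_ciSup ma ⟨M, by rintro _ ⟨n, rfl⟩; exact (leM n).1⟩
  have tA := tendsto_atTop_ciInf mA ⟨h₀, by rintro _ ⟨n, rfl⟩; exact (geA n).1⟩
  have tb := tendsto_atTop_ciSup mb ⟨M, by rintro _ ⟨n, rfl⟩; exact (leM n).2⟩
  have tB := tendsto_atTop_ciInf mB ⟨h₁, by rintro _ ⟨n, rfl⟩; exact (geA n).2⟩
  have tu := ta.prodMk_nhds (tA.prodMk_nhds (tb.prodMk_nhds tB))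
  have hcont : Continuous T := by
    rw [hT]; unfold rickerEmbedding; fun_prop
  refine ⟨u, _, tu, ?_, ge_of_tendsto' ta fun n => (nested n).1.1,
    ge_of_tendsto' tB fun n => (geA n).2, fun n => (nested n).2.1⟩
  refine tendsto_nhds_unique ((hcont.tendsto _).comp tu) ?_
  refine ((tendsto_add_atTop_iff_nat 1).2 tu).congr fun n => ?_
  exact hsucc n

/-- If `h₀, h₁ > r`, `h₀ ≠ h₁`, and the system characterizing the fixed points of the
composed embedding `G₁ ∘ G₀` has the 2-cycle `(z₀, z₁)` as its unique positive solution,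
then the 2-cycle is globally asymptotically stable: even-indexed terms converge to `z₁`
and odd-indexed terms converge to `z₀`. -/
theorem ricker_periodic_stocking_global_stability (r h₀ h₁ z₀ z₁ : ℝ)
    (hr : 0 < r) (hh₀ : r < h₀) (hh₁ : r < h₁) (hne : h₀ ≠ h₁)
    (hz₀ : 0 < z₀) (hz₁ : 0 < z₁)
    (heq₀ : z₀ = z₁ * Real.exp (r - z₀) + h₁)
    (heq₁ : z₁ = z₀ * Real.exp (r - z₁) + h₀)
    (huniq : ∀ x y : ℝ, 0 < x → 0 < y →
      x - h₁ = (x * Real.exp (r - y) + h₀) *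
          Real.exp (r - (y * Real.exp (r - x) + h₁)) →
      y - h₀ = (y * Real.exp (r - x) + h₁) *
          Real.exp (r - (x * Real.exp (r - y) + h₀)) →
      x = z₀ ∧ y = z₁)
    (y : ℕ → ℝ) (hy0 : 0 ≤ y 0) (hy1 : 0 ≤ y 1)
    (hrec : ∀ n : ℕ,
      y (n + 2) = y (n + 1) * Real.exp (r - y n) + (if n % 2 = 0 then h₀ else h₁)) :
    Filter.Tendsto (fun n => y (2 * n)) Filter.atTop (nhds z₁) ∧
    Filter.Tendsto (fun n => y (2 * n + 1)) Filter.atTop (nhds z₀) := by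
  have h₀pos : 0 < h₀ := hr.trans hh₀
  have h₁pos : 0 < h₁ := hr.trans hh₁
  have hes : ∀ n, y (2 * (n + 1)) = y (2 * n + 1) * Real.exp (r - y (2 * n)) + h₀ := fun n => by
    simpa [mul_add] using hrec (2 * n)
  have hos : ∀ n, y (2 * (n + 1) + 1) = y (2 * (n + 1)) * Real.exp (r - y (2 * n + 1)) + h₁ :=
    fun n => by simpa [Nat.add_mod, mul_add, add_right_comm] using hrec (2 * n + 1)
  have hy2 : h₀ ≤ y 2 := by
    rw [hes 0]; exact le_add_of_nonneg_left (mul_nonneg hy1 (Real.exp_nonneg _))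
  have hy3 : h₁ ≤ y 3 := by
    rw [hos 0]
    exact le_add_of_nonneg_left (mul_nonneg (h₀pos.le.trans hy2) (Real.exp_nonneg _))
  obtain ⟨M, hM⟩ := (({h₀ / (1 - Real.exp (r - h₀)), h₁ / (1 - Real.exp (r - h₁)), y 2, y 3} :
    Finset ℝ)).exists_le
  simp only [Finset.mem_insert, Finset.mem_singleton, forall_eq_or_imp, forall_eq] at hM
  obtain ⟨hM₀, hM₁, hM2, hM3⟩ := hM
  obtain ⟨u, ⟨a, A, b, B⟩, tu, hfix, ha, hB, hbox⟩ := exists_tendsto_ricker_bounds h₀pos h₁pos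
    (ricker_term_le_self hM₀ hh₀) (ricker_term_le_self hM₁ hh₁)
    (fun n => y (2 * (n + 1))) (fun n => y (2 * (n + 1) + 1)) ⟨hy2, hM2⟩ ⟨hy3, hM3⟩
    (fun n => hes (n + 1)) (fun n => hos (n + 1))
  simp only [rickerEmbedding, Prod.mk.injEq] at hfix ha hB
  obtain ⟨fa, fA, fb, fB⟩ := hfix
  obtain ⟨rfl, rfl⟩ := huniq B a (by linarith) (by linarith)
    (by rw [fA, fb]; linarith) (by rw [fA, fb]; linarith)
  obtain rfl : A = a := by linarith
  obtain rfl : b = B := by linarith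
  have tea := (continuous_fst.tendsto _).comp tu
  have t2 := (continuous_snd.tendsto _).comp tu
  have teA := (continuous_fst.tendsto _).comp t2
  have t3 := (continuous_snd.tendsto _).comp t2
  have tob := (continuous_fst.tendsto _).comp t3
  have toB := (continuous_snd.tendsto _).comp t3
  constructor
  · refine (tendsto_add_atTop_iff_nat (f := fun n => y (2 * n)) 1).1 ?_
    exact tendsto_of_tendsto_of_tendsto_of_le_of_le tea teA
      (fun n => (hbox n).1.1) (fun n => (hbox n).1.2)
  · refine (tendsto_add_atTop_iff_nat (f := fun n => y (2 * n + 1)) 1).1 ?_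
    exact tendsto_of_tendsto_of_tendsto_of_le_of_le tob toB
      (fun n => (hbox n).2.1) (fun n => (hbox n).2.2)
end
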